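/- arXiv:0905.0478 — 5 statements merged into one kernel-verified Lean document; each statement's English description precedes it below -/
import Mathlib

section
/- Let E be a graph and R a commutative ring with unit. Then the Leavitt path algebra L_R(E) admits a Z-grading in which the homogeneous component of degree k is L_R(E)_k = { Σᵢ rᵢ αᵢ βᵢ* : αᵢ, βᵢ ∈ E*, rᵢ ∈ R, and |αᵢ| − |βᵢ| = k for all i }. -/
set_option maxHeartbeats 1000000
set_option synthInstance.maxHeartbeats 400000

noncomputable section

/-- A directed graph `E = (E⁰, E¹, r, s)` with countable vertex and edge sets,
together with range and source maps. -/
structure LPAGraph : Type 1 where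
  V : Type
  E : Type
  countV : Countable V
  countE : Countable E
  src : E → V
  rng : E → V

namespace LPAGraph

/-- Generators of the Leavitt path algebra: vertices, real edges, and ghost edges. -/
inductive LGen (G : LPAGraph) : Type
  | vert : G.V → LGen G
  | edge : G.E → LGen G
  | ghost : G.E → LGen G

/-- `IsPathFrom G u es w` : the list of edges `es` is a path from `u` to `w`
(paths of length zero are vertices). -/
inductive IsPathFrom (G : LPAGraph) : G.V → List G.E → G.V → Prop
  | nil (v : G.V) : IsPathFrom G v [] v
  | cons {u w : G.V} (e : G.E) {es : List G.E} (h : G.src e = u)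
      (ht : IsPathFrom G (G.rng e) es w) : IsPathFrom G u (e :: es) w

/-- A vertex is regular if it emits at least one and only finitely many edges. -/
def Regular (G : LPAGraph) (v : G.V) : Prop :=
  {e : G.E | G.src e = v}.Finite ∧ {e : G.E | G.src e = v}.Nonempty

/-- A graph is row-finite if every vertex emits only finitely many edges. -/
def RowFinite (G : LPAGraph) : Prop := ∀ v : G.V, {e : G.E | G.src e = v}.Finite

/-- A subset `H` of vertices is hereditary if `s(e) ∈ H` implies `r(e) ∈ H`. -/
def Hereditary (G : LPAGraph) (H : Set G.V) : Prop :=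
  ∀ e : G.E, G.src e ∈ H → G.rng e ∈ H

/-- A subset `H` of vertices is saturated if every regular vertex, all of whose emitted
edges have range in `H`, belongs to `H`. -/
def Saturated (G : LPAGraph) (H : Set G.V) : Prop :=
  ∀ v : G.V, G.Regular v → (∀ e : G.E, G.src e = v → G.rng e ∈ H) → v ∈ H

/-- The saturation of a set of vertices: the smallest saturated hereditary subset
containing it. -/
def saturation (G : LPAGraph) (X : Set G.V) : Set G.V :=
  ⋂₀ {H : Set G.V | G.Hereditary H ∧ G.Saturated H ∧ X ⊆ H}

/-- `HasExit G es` : the path `es` has an exit, i.e. there is an edge `f` with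
`s(f) = s(eᵢ)` and `f ≠ eᵢ` for some `i`. -/
def HasExit (G : LPAGraph) (es : List G.E) : Prop :=
  ∃ (f : G.E) (i : Fin es.length), G.src f = G.src (es.get i) ∧ f ≠ es.get i

/-- Condition (L): every cycle has an exit. -/
def CondL (G : LPAGraph) : Prop :=
  ∀ (v : G.V) (es : List G.E), es ≠ [] → IsPathFrom G v es v → G.HasExit es

/-- A closed path based at `v`. -/
def IsClosedPathAt (G : LPAGraph) (v : G.V) (es : List G.E) : Prop :=
  es ≠ [] ∧ IsPathFrom G v es v

/-- A simple closed path based at `v` : a closed path `e₁ … eₙ` based at `v` with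
`s(eᵢ) ≠ v` for `i = 2, …, n`. -/
def IsSimpleClosedPathAt (G : LPAGraph) (v : G.V) (es : List G.E) : Prop :=
  G.IsClosedPathAt v es ∧ ∀ i : Fin es.length, i.1 ≠ 0 → G.src (es.get i) ≠ v

/-- Condition (K): every vertex is the base of no closed path or of at least two
distinct simple closed paths. -/
def CondK (G : LPAGraph) : Prop :=
  ∀ v : G.V, (¬ ∃ es : List G.E, G.IsClosedPathAt v es) ∨
    (∃ es₁ es₂ : List G.E, G.IsSimpleClosedPathAt v es₁ ∧ G.IsSimpleClosedPathAt v es₂ ∧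
      es₁ ≠ es₂)

variable (R : Type) [CommRing R] (G : LPAGraph)

open FreeAlgebra in
/-- The defining relations of the Leavitt path algebra (the relations of a
Leavitt `E`-family). -/
inductive LeavittRel : FreeAlgebra R (LGen G) → FreeAlgebra R (LGen G) → Prop
  | vert_mul_self (v : G.V) :
      LeavittRel (ι R (LGen.vert v) * ι R (LGen.vert v)) (ι R (LGen.vert v))
  | vert_mul_vert (v w : G.V) (hvw : v ≠ w) :
      LeavittRel (ι R (LGen.vert v) * ι R (LGen.vert w)) 0
  | src_mul_edge (e : G.E) :
      LeavittRel (ι R (LGen.vert (G.src e)) * ι R (LGen.edge e)) (ι R (LGen.edge e))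
  | edge_mul_rng (e : G.E) :
      LeavittRel (ι R (LGen.edge e) * ι R (LGen.vert (G.rng e))) (ι R (LGen.edge e))
  | rng_mul_ghost (e : G.E) :
      LeavittRel (ι R (LGen.vert (G.rng e)) * ι R (LGen.ghost e)) (ι R (LGen.ghost e))
  | ghost_mul_src (e : G.E) :
      LeavittRel (ι R (LGen.ghost e) * ι R (LGen.vert (G.src e))) (ι R (LGen.ghost e))
  | ghost_mul_self (e : G.E) :
      LeavittRel (ι R (LGen.ghost e) * ι R (LGen.edge e)) (ι R (LGen.vert (G.rng e)))
  | ghost_mul_edge (e f : G.E) (hef : e ≠ f) :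
      LeavittRel (ι R (LGen.ghost e) * ι R (LGen.edge f)) 0
  | ck (v : G.V) (s : Finset G.E) (hs : ∀ e : G.E, e ∈ s ↔ G.src e = v) (hne : s.Nonempty) :
      LeavittRel (ι R (LGen.vert v)) (∑ e ∈ s, ι R (LGen.edge e) * ι R (LGen.ghost e))

/-- The ambient unital algebra: the universal unital `R`-algebra on the Leavitt relations. -/
abbrev Ambient : Type := RingQuot (LeavittRel R G)

/-- The images of the generators in the ambient algebra. -/
def ugen (x : LGen G) : Ambient R G :=
  RingQuot.mkAlgHom R (LeavittRel R G) (FreeAlgebra.ι R x)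

/-- The Leavitt path algebra `L_R(E)`, realized as the non-unital subalgebra of the ambient
algebra generated by the Leavitt `E`-family (equivalently, the span of words in the
generators). -/
def LeavittSubalgebra : NonUnitalSubalgebra R (Ambient R G) :=
  NonUnitalAlgebra.adjoin R (Set.range (ugen R G))

/-- The Leavitt path algebra `L_R(E)` as a type; it is a non-unital `R`-algebra. -/
abbrev LeavittPathAlgebra : Type := ↥(LeavittSubalgebra R G)

theorem ugen_mem (x : LGen G) : ugen R G x ∈ LeavittSubalgebra R G :=
  NonUnitalAlgebra.subset_adjoin R (Set.mem_range_self x)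

/-- The vertex idempotent `v ∈ L_R(E)`. -/
def vertexElem (v : G.V) : LeavittPathAlgebra R G :=
  ⟨ugen R G (LGen.vert v), ugen_mem R G _⟩

/-- The real edge `e ∈ L_R(E)`. -/
def edgeElem (e : G.E) : LeavittPathAlgebra R G :=
  ⟨ugen R G (LGen.edge e), ugen_mem R G _⟩

/-- The ghost edge `e* ∈ L_R(E)`. -/
def ghostElem (e : G.E) : LeavittPathAlgebra R G :=
  ⟨ugen R G (LGen.ghost e), ugen_mem R G _⟩

/-- The element `α = e₁ ⋯ eₙ` of the ambient algebra corresponding to a path; a path of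
length zero starting at `u` is the vertex `u`. -/
def uPath (u : G.V) (es : List G.E) : Ambient R G :=
  ugen R G (LGen.vert u) * (es.map fun e => ugen R G (LGen.edge e)).prod

/-- The element `α* = eₙ* ⋯ e₁*` of the ambient algebra corresponding to a ghost path. -/
def uGhostPath (u : G.V) (es : List G.E) : Ambient R G :=
  ((es.map fun e => ugen R G (LGen.ghost e)).reverse).prod * ugen R G (LGen.vert u)

private theorem list_prod_mem_aux (f : G.E → Ambient R G)
    (hf : ∀ e, f e ∈ LeavittSubalgebra R G) :
    ∀ es : List G.E, es ≠ [] → (es.map f).prod ∈ LeavittSubalgebra R G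
  | [], h => absurd rfl h
  | [e], _ => by simpa using hf e
  | e :: e' :: t, _ => by
      rw [List.map_cons, List.prod_cons]
      exact mul_mem (hf e) (list_prod_mem_aux f hf (e' :: t) (by simp))

theorem uPath_mem (u : G.V) (es : List G.E) : uPath R G u es ∈ LeavittSubalgebra R G := by
  cases es with
  | nil => simpa [uPath] using ugen_mem R G (LGen.vert u)
  | cons e t =>
      exact mul_mem (ugen_mem R G (LGen.vert u))
        (list_prod_mem_aux R G _ (fun e => ugen_mem R G (LGen.edge e)) (e :: t) (by simp))

theorem uGhostPath_mem (u : G.V) (es : List G.E) :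
    uGhostPath R G u es ∈ LeavittSubalgebra R G := by
  cases es with
  | nil => simpa [uGhostPath] using ugen_mem R G (LGen.vert u)
  | cons e t =>
      rw [uGhostPath, ← List.map_reverse]
      exact mul_mem
        (list_prod_mem_aux R G _ (fun e => ugen_mem R G (LGen.ghost e)) ((e :: t).reverse)
          (by simp))
        (ugen_mem R G (LGen.vert u))

/-- The element of `L_R(E)` corresponding to the path `α` with source `u` and edge list
`es` (for `es = []` this is the vertex `u`). -/
def pathElem (u : G.V) (es : List G.E) : LeavittPathAlgebra R G :=
  ⟨uPath R G u es, uPath_mem R G u es⟩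

/-- The element of `L_R(E)` corresponding to the ghost path `α*` where `α` has source `u`
and edge list `es` (for `es = []` this is the vertex `u`). -/
def ghostPathElem (u : G.V) (es : List G.E) : LeavittPathAlgebra R G :=
  ⟨uGhostPath R G u es, uGhostPath_mem R G u es⟩

/-- The set of monomials `α β*` where `α, β` are paths with `r(α) = r(β)`. -/
def monomialSet : Set (LeavittPathAlgebra R G) :=
  {x | ∃ (u : G.V) (es : List G.E) (u' : G.V) (es' : List G.E) (w : G.V),
    IsPathFrom G u es w ∧ IsPathFrom G u' es' w ∧
    x = pathElem R G u es * ghostPathElem R G u' es'}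

/-- The degree-`k` homogeneous component `L_R(E)ₖ` of the canonical `ℤ`-grading:
the `R`-span of the monomials `α β*` with `|α| - |β| = k`. -/
def component (k : ℤ) : Submodule R (LeavittPathAlgebra R G) :=
  Submodule.span R
    {x | ∃ (u : G.V) (es : List G.E) (u' : G.V) (es' : List G.E) (w : G.V),
      IsPathFrom G u es w ∧ IsPathFrom G u' es' w ∧
      (es.length : ℤ) - (es'.length : ℤ) = k ∧
      x = pathElem R G u es * ghostPathElem R G u' es'}

/-- An ideal `I` of `L_R(E)` is basic if `r • v ∈ I` with `r ∈ R \ {0}` and `v` a vertex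
implies `v ∈ I`. -/
def IsBasicIdeal (I : TwoSidedIdeal (LeavittPathAlgebra R G)) : Prop :=
  ∀ (r : R) (v : G.V), r ≠ 0 → r • vertexElem R G v ∈ I → vertexElem R G v ∈ I

/-- An ideal `I` of the `ℤ`-graded ring `L_R(E)` is graded if `I = ⊕ₖ (I ∩ L_R(E)ₖ)`,
i.e. every element of `I` is a finite sum of homogeneous elements of `I`. -/
def IsGradedIdeal (I : TwoSidedIdeal (LeavittPathAlgebra R G)) : Prop :=
  ∀ x ∈ I, ∃ (n : ℕ) (c : Fin n → LeavittPathAlgebra R G),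
    (∀ i, c i ∈ I ∧ ∃ k : ℤ, c i ∈ component R G k) ∧ x = ∑ i, c i

/-- The two-sided ideal of `L_R(E)` generated by the vertices in a set `H` of vertices. -/
def idealOfSet (H : Set G.V) : TwoSidedIdeal (LeavittPathAlgebra R G) :=
  TwoSidedIdeal.span {x | ∃ v ∈ H, x = vertexElem R G v}

/-- `x ∈ L_R(E)` is a polynomial in only real edges if it is an `R`-linear combination of
(real) paths. -/
def IsRealPoly (x : LeavittPathAlgebra R G) : Prop :=
  x ∈ Submodule.span R
    {y | ∃ (u : G.V) (es : List G.E) (w : G.V), IsPathFrom G u es w ∧ y = pathElem R G u es}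

end LPAGraph

namespace LPAGraph

section GradingProof

variable (R : Type) [CommRing R] (G : LPAGraph)

theorem gp_rel {a b : FreeAlgebra R (LGen G)} (h : LeavittRel R G a b) :
    RingQuot.mkAlgHom R (LeavittRel R G) a = RingQuot.mkAlgHom R (LeavittRel R G) b :=
  RingQuot.mkAlgHom_rel R h

theorem gp_vv (v : G.V) :
    ugen R G (LGen.vert v) * ugen R G (LGen.vert v) = ugen R G (LGen.vert v) := by
  simpa [ugen] using gp_rel R G (LeavittRel.vert_mul_self v)

theorem gp_vw (v w : G.V) (h : v ≠ w) :
    ugen R G (LGen.vert v) * ugen R G (LGen.vert w) = 0 := by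
  simpa [ugen] using gp_rel R G (LeavittRel.vert_mul_vert v w h)

theorem gp_se (e : G.E) :
    ugen R G (LGen.vert (G.src e)) * ugen R G (LGen.edge e) = ugen R G (LGen.edge e) := by
  simpa [ugen] using gp_rel R G (LeavittRel.src_mul_edge e)

theorem gp_er (e : G.E) :
    ugen R G (LGen.edge e) * ugen R G (LGen.vert (G.rng e)) = ugen R G (LGen.edge e) := by
  simpa [ugen] using gp_rel R G (LeavittRel.edge_mul_rng e)

theorem gp_rg (e : G.E) :
    ugen R G (LGen.vert (G.rng e)) * ugen R G (LGen.ghost e) = ugen R G (LGen.ghost e) := by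
  simpa [ugen] using gp_rel R G (LeavittRel.rng_mul_ghost e)

theorem gp_gs (e : G.E) :
    ugen R G (LGen.ghost e) * ugen R G (LGen.vert (G.src e)) = ugen R G (LGen.ghost e) := by
  simpa [ugen] using gp_rel R G (LeavittRel.ghost_mul_src e)

theorem gp_ge (e : G.E) :
    ugen R G (LGen.ghost e) * ugen R G (LGen.edge e) = ugen R G (LGen.vert (G.rng e)) := by
  simpa [ugen] using gp_rel R G (LeavittRel.ghost_mul_self e)

theorem gp_gf (e f : G.E) (h : e ≠ f) :
    ugen R G (LGen.ghost e) * ugen R G (LGen.edge f) = 0 := by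
  simpa [ugen] using gp_rel R G (LeavittRel.ghost_mul_edge e f h)

theorem gp_ck (v : G.V) (s : Finset G.E) (hs : ∀ e : G.E, e ∈ s ↔ G.src e = v)
    (hne : s.Nonempty) :
    ugen R G (LGen.vert v) = ∑ e ∈ s, ugen R G (LGen.edge e) * ugen R G (LGen.ghost e) := by
  simpa [ugen] using gp_rel R G (LeavittRel.ck v s hs hne)

/-- degree of a generator -/
def gpDeg : LGen G → ℤ
  | .vert _ => 0
  | .edge _ => 1
  | .ghost _ => -1

/-- The grading homomorphism. -/
def gpHom : Ambient R G →ₐ[R] AddMonoidAlgebra (Ambient R G) ℤ :=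
  RingQuot.liftAlgHom R ⟨FreeAlgebra.lift R
    (fun x => AddMonoidAlgebra.single (gpDeg G x) (ugen R G x)), by
    intro a b h
    induction h with
    | vert_mul_self v =>
      simp only [FreeAlgebra.lift_ι_apply, map_mul, map_zero, gpDeg,
        AddMonoidAlgebra.single_mul_single, gp_vv, add_zero, zero_add, neg_add_cancel,
        AddMonoidAlgebra.single_zero]
    | vert_mul_vert v w h =>
      simp only [FreeAlgebra.lift_ι_apply, map_mul, map_zero, gpDeg,
        AddMonoidAlgebra.single_mul_single, gp_vw _ _ _ _ h, add_zero, zero_add, neg_add_cancel,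
        AddMonoidAlgebra.single_zero]
    | src_mul_edge e =>
      simp only [FreeAlgebra.lift_ι_apply, map_mul, map_zero, gpDeg,
        AddMonoidAlgebra.single_mul_single, gp_se, add_zero, zero_add, neg_add_cancel,
        AddMonoidAlgebra.single_zero]
    | edge_mul_rng e =>
      simp only [FreeAlgebra.lift_ι_apply, map_mul, map_zero, gpDeg,
        AddMonoidAlgebra.single_mul_single, gp_er, add_zero, zero_add, neg_add_cancel,
        AddMonoidAlgebra.single_zero]
    | rng_mul_ghost e =>
      simp only [FreeAlgebra.lift_ι_apply, map_mul, map_zero, gpDeg,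
        AddMonoidAlgebra.single_mul_single, gp_rg, add_zero, zero_add, neg_add_cancel,
        AddMonoidAlgebra.single_zero]
    | ghost_mul_src e =>
      simp only [FreeAlgebra.lift_ι_apply, map_mul, map_zero, gpDeg,
        AddMonoidAlgebra.single_mul_single, gp_gs, add_zero, zero_add, neg_add_cancel,
        AddMonoidAlgebra.single_zero]
    | ghost_mul_self e =>
      simp only [FreeAlgebra.lift_ι_apply, map_mul, map_zero, gpDeg,
        AddMonoidAlgebra.single_mul_single, gp_ge, add_zero, zero_add, neg_add_cancel,
        AddMonoidAlgebra.single_zero]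
    | ghost_mul_edge e f h =>
      simp only [FreeAlgebra.lift_ι_apply, map_mul, map_zero, gpDeg,
        AddMonoidAlgebra.single_mul_single, gp_gf _ _ _ _ h, add_zero, zero_add, neg_add_cancel,
        AddMonoidAlgebra.single_zero]
    | ck v s hs hne =>
      simp only [FreeAlgebra.lift_ι_apply, map_sum, map_mul, gpDeg,
        AddMonoidAlgebra.single_mul_single]
      rw [gp_ck R G v s hs hne]
      simp only [add_neg_cancel]
      exact map_sum (AddMonoidAlgebra.singleAddHom (0 : ℤ)) _ _⟩

theorem gpHom_ugen (x : LGen G) :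
    gpHom R G (ugen R G x) = AddMonoidAlgebra.single (gpDeg G x) (ugen R G x) := by
  simp [gpHom, ugen]

theorem gpHom_uPath (u : G.V) (es : List G.E) :
    gpHom R G (uPath R G u es) = AddMonoidAlgebra.single (es.length : ℤ) (uPath R G u es) := by
  have h : gpHom R G (es.map fun e => ugen R G (LGen.edge e)).prod =
      AddMonoidAlgebra.single (es.length : ℤ) (es.map fun e => ugen R G (LGen.edge e)).prod := by
    induction es with
    | nil =>
      simp only [List.map_nil, List.reverse_nil, List.prod_nil, map_one, List.length_nil,
        Nat.cast_zero, neg_zero, AddMonoidAlgebra.one_def]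
    | cons e t ih =>
      rw [List.map_cons, List.prod_cons, map_mul, ih, gpHom_ugen,
        AddMonoidAlgebra.single_mul_single]
      simp [gpDeg, add_comm]
  rw [uPath, map_mul, h, gpHom_ugen, AddMonoidAlgebra.single_mul_single]
  simp [gpDeg]

theorem gpHom_uGhostPath (u : G.V) (es : List G.E) :
    gpHom R G (uGhostPath R G u es) =
      AddMonoidAlgebra.single (-(es.length : ℤ)) (uGhostPath R G u es) := by
  have h : gpHom R G ((es.map fun e => ugen R G (LGen.ghost e)).reverse).prod =
      AddMonoidAlgebra.single (-(es.length : ℤ))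
        ((es.map fun e => ugen R G (LGen.ghost e)).reverse).prod := by
    induction es with
    | nil =>
      simp only [List.map_nil, List.reverse_nil, List.prod_nil, map_one, List.length_nil,
        Nat.cast_zero, neg_zero, AddMonoidAlgebra.one_def]
    | cons e t ih =>
      rw [List.map_cons, List.reverse_cons, List.prod_append, List.prod_singleton, map_mul, ih,
        gpHom_ugen, AddMonoidAlgebra.single_mul_single]
      simp [gpDeg, add_comm]
  rw [uGhostPath, map_mul, h, gpHom_ugen, AddMonoidAlgebra.single_mul_single]
  simp [gpDeg]

/-- Homogeneous components in the ambient algebra. -/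
def gpC (k : ℤ) : Submodule R (Ambient R G) :=
  Submodule.span R
    {x | ∃ (u : G.V) (es : List G.E) (u' : G.V) (es' : List G.E) (w : G.V),
      IsPathFrom G u es w ∧ IsPathFrom G u' es' w ∧
      (es.length : ℤ) - (es'.length : ℤ) = k ∧
      x = uPath R G u es * uGhostPath R G u' es'}

theorem gp_map_component (k : ℤ) :
    (component R G k).map (LeavittSubalgebra R G).toSubmodule.subtype = gpC R G k := by
  have := Submodule.map_span (LeavittSubalgebra R G).toSubmodule.subtype
    {x | ∃ (u : G.V) (es : List G.E) (u' : G.V) (es' : List G.E) (w : G.V),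
      IsPathFrom G u es w ∧ IsPathFrom G u' es' w ∧
      (es.length : ℤ) - (es'.length : ℤ) = k ∧
      x = pathElem R G u es * ghostPathElem R G u' es'}
  refine Eq.trans this ?_
  rw [gpC]
  congr 1
  ext x
  constructor
  · rintro ⟨y, ⟨u, es, u', es', w, h1, h2, h3, rfl⟩, rfl⟩
    exact ⟨u, es, u', es', w, h1, h2, h3, rfl⟩
  · rintro ⟨u, es, u', es', w, h1, h2, h3, rfl⟩
    exact ⟨_, ⟨u, es, u', es', w, h1, h2, h3, rfl⟩, rfl⟩

theorem gp_mem_component (k : ℤ) (x : LeavittPathAlgebra R G) :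
    x ∈ component R G k ↔ (x : Ambient R G) ∈ gpC R G k := by
  rw [← gp_map_component]
  constructor
  · intro h
    exact ⟨x, h, rfl⟩
  · rintro ⟨y, hy, hxy⟩
    have : y = x := Subtype.ext hxy
    exact this ▸ hy

theorem gpHom_gpC (k : ℤ) (x : Ambient R G) (hx : x ∈ gpC R G k) :
    gpHom R G x = AddMonoidAlgebra.single k x := by
  induction hx using Submodule.span_induction with
  | mem x h =>
    obtain ⟨u, es, u', es', w, h1, h2, rfl, rfl⟩ := h
    rw [map_mul, gpHom_uPath, gpHom_uGhostPath, AddMonoidAlgebra.single_mul_single, sub_eq_add_neg]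
  | zero => simp
  | add x y _ _ hx hy => rw [map_add, hx, hy, AddMonoidAlgebra.single_add]
  | smul r x _ hx => rw [map_smul, hx, AddMonoidAlgebra.smul_single]

theorem gp_uPath_vert {u w : G.V} {es : List G.E} (h : IsPathFrom G u es w) :
    uPath R G u es * ugen R G (LGen.vert w) = uPath R G u es := by
  have key : es = [] ∨ (es.map fun e => ugen R G (LGen.edge e)).prod * ugen R G (LGen.vert w)
      = (es.map fun e => ugen R G (LGen.edge e)).prod := by
    induction h with
    | nil v => exact Or.inl rfl
    | cons e hs ht ih =>
      right
      rw [List.map_cons, List.prod_cons, mul_assoc]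
      rcases ih with rfl | ih
      · cases ht
        simp [gp_er]
      · rw [ih]
  rcases key with rfl | key
  · cases h
    simp [uPath, gp_vv]
  · rw [uPath, mul_assoc, key]

theorem gp_path_snoc {u w : G.V} {es : List G.E} (h : IsPathFrom G u es w) (e : G.E)
    (he : G.src e = w) : IsPathFrom G u (es ++ [e]) (G.rng e) := by
  induction h with
  | nil v => exact .cons e he (.nil _)
  | cons f hs ht ih => exact .cons f hs (ih he)

theorem gp_uPath_snoc (u : G.V) (es : List G.E) (e : G.E) :
    uPath R G u (es ++ [e]) = uPath R G u es * ugen R G (LGen.edge e) := by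
  simp [uPath, mul_assoc]

theorem gp_ghost_cons (e : G.E) (es : List G.E) :
    uGhostPath R G (G.src e) (e :: es) =
      uGhostPath R G (G.rng e) es * ugen R G (LGen.ghost e) := by
  simp only [uGhostPath, List.map_cons, List.reverse_cons, List.prod_append, List.prod_singleton,
    mul_assoc, gp_gs, gp_rg]

theorem gp_ghost_vert (u : G.V) (es : List G.E) :
    uGhostPath R G u es * ugen R G (LGen.vert u) = uGhostPath R G u es := by
  rw [uGhostPath, mul_assoc, gp_vv]

theorem gp_ghost_nil (u : G.V) : uGhostPath R G u [] = ugen R G (LGen.vert u) := by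
  simp [uGhostPath]

theorem gp_vert_mul (x : Ambient R G) (b : LGen G) (u v : G.V)
    (hx : x * ugen R G (LGen.vert u) = x)
    (hb : ugen R G (LGen.vert v) * ugen R G b = ugen R G b) (huv : u ≠ v) :
    x * ugen R G b = 0 := by
  rw [← hx, ← hb, mul_assoc, ← mul_assoc (ugen R G (LGen.vert u)), gp_vw _ _ _ _ huv]
  simp

theorem gp_mul_gen (j : ℤ) (x : Ambient R G) (hx : x ∈ gpC R G j) (g : LGen G) :
    x * ugen R G g ∈ gpC R G (j + gpDeg G g) := by
  induction hx using Submodule.span_induction with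
  | zero => simp
  | add x y _ _ hx hy => rw [add_mul]; exact add_mem hx hy
  | smul r x _ hx => rw [smul_mul_assoc]; exact Submodule.smul_mem _ _ hx
  | mem x h =>
    obtain ⟨u, es, u', es', w, h1, h2, rfl, rfl⟩ := h
    have hv : (uPath R G u es * uGhostPath R G u' es') * ugen R G (LGen.vert u') =
        uPath R G u es * uGhostPath R G u' es' := by
      rw [mul_assoc, gp_ghost_vert]
    cases g with
    | vert v =>
      by_cases h : u' = v
      · subst h
        rw [hv]
        exact Submodule.subset_span ⟨u, es, u', es', w, h1, h2, by simp [gpDeg], rfl⟩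
      · rw [gp_vert_mul R G _ (LGen.vert v) u' v hv (gp_vv R G v) h]
        exact zero_mem _
    | ghost e =>
      by_cases h : u' = G.rng e
      · subst h
        rw [mul_assoc, ← gp_ghost_cons]
        refine Submodule.subset_span ⟨u, es, G.src e, e :: es', w, h1, .cons e rfl h2, ?_, rfl⟩
        simp [gpDeg]; ring
      · rw [gp_vert_mul R G _ (LGen.ghost e) u' _ hv (gp_rg R G e) h]
        exact zero_mem _
    | edge e =>
      by_cases h : u' = G.src e
      · cases h2 with
        | nil =>
          rw [gp_ghost_nil, gp_uPath_vert R G h1, ← gp_uPath_snoc]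
          have h3 := gp_path_snoc G h1 e h.symm
          refine Submodule.subset_span ⟨u, es ++ [e], G.rng e, [], G.rng e, h3, .nil _, ?_, ?_⟩
          · simp [gpDeg]
          · rw [gp_ghost_nil, gp_uPath_vert R G h3]
        | cons f hf ht =>
          subst hf
          rw [gp_ghost_cons, mul_assoc, mul_assoc]
          by_cases hfe : f = e
          · subst hfe
            rw [gp_ge, gp_ghost_vert]
            refine Submodule.subset_span ⟨u, es, G.rng f, _, w, h1, ht, ?_, rfl⟩
            simp [gpDeg]; ring
          · rw [gp_gf _ _ _ _ hfe]
            simp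
      · rw [gp_vert_mul R G _ (LGen.edge e) u' _ hv (gp_se R G e) h]
        exact zero_mem _

theorem gp_mul_path (j : ℤ) (x : Ambient R G) (hx : x ∈ gpC R G j) (u : G.V) (es : List G.E) :
    x * uPath R G u es ∈ gpC R G (j + es.length) := by
  induction es using List.reverseRecOn with
  | nil => simpa [uPath, gpDeg] using gp_mul_gen R G j x hx (LGen.vert u)
  | append_singleton t e ih =>
    rw [gp_uPath_snoc, ← mul_assoc]
    have := gp_mul_gen R G _ _ ih (LGen.edge e)
    simpa [gpDeg, add_assoc] using this

theorem gp_mul_ghost (j : ℤ) (x : Ambient R G) (hx : x ∈ gpC R G j) (u : G.V) (es : List G.E) :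
    x * uGhostPath R G u es ∈ gpC R G (j - es.length) := by
  have key : ∀ (j : ℤ) (x : Ambient R G), x ∈ gpC R G j →
      x * ((es.map fun e => ugen R G (LGen.ghost e)).reverse).prod ∈ gpC R G (j - es.length) := by
    induction es with
    | nil => intro j x hx; simpa using hx
    | cons e t ih =>
      intro j x hx
      rw [List.map_cons, List.reverse_cons, List.prod_append, List.prod_singleton, ← mul_assoc]
      have := gp_mul_gen R G _ _ (ih j x hx) (LGen.ghost e)
      have h2 : j - ((e :: t).length : ℤ) = j - t.length + gpDeg G (LGen.ghost e) := by
        simp [gpDeg]; ring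
      rw [h2]; exact this
  have := gp_mul_gen R G _ _ (key j x hx) (LGen.vert u)
  rw [uGhostPath, ← mul_assoc]
  simpa [gpDeg] using this

theorem gp_mul (j k : ℤ) (x y : Ambient R G) (hx : x ∈ gpC R G j) (hy : y ∈ gpC R G k) :
    x * y ∈ gpC R G (j + k) := by
  induction hy using Submodule.span_induction with
  | zero => simp
  | add y z _ _ hy hz => rw [mul_add]; exact add_mem hy hz
  | smul r y _ hy => rw [mul_smul_comm]; exact Submodule.smul_mem _ _ hy
  | mem y h =>
    obtain ⟨u, es, u', es', w, h1, h2, rfl, rfl⟩ := h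
    rw [← mul_assoc]
    have := gp_mul_ghost R G _ _ (gp_mul_path R G j x hx u es) u' es'
    rwa [add_sub_assoc] at this

theorem gp_gen_mem (g : LGen G) : ugen R G g ∈ gpC R G (gpDeg G g) := by
  have hv : ∀ v : G.V, ugen R G (LGen.vert v) ∈ gpC R G 0 := fun v =>
    Submodule.subset_span ⟨v, [], v, [], v, .nil v, .nil v, by simp,
      by simp [uPath, uGhostPath, gp_vv]⟩
  cases g with
  | vert v => exact hv v
  | edge e =>
    have := gp_mul_gen R G 0 _ (hv (G.src e)) (LGen.edge e)
    rwa [gp_se, zero_add] at this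
  | ghost e =>
    have := gp_mul_gen R G 0 _ (hv (G.rng e)) (LGen.ghost e)
    rwa [gp_rg, zero_add] at this

theorem gp_iSup_top : (⨆ k : ℤ, component R G k) = ⊤ := by
  have hS : ∀ x ∈ LeavittSubalgebra R G, x ∈ (⨆ k : ℤ, gpC R G k) ∧
      ∀ y ∈ (⨆ k : ℤ, gpC R G k), y * x ∈ (⨆ k : ℤ, gpC R G k) := by
    intro x hx
    induction hx using NonUnitalAlgebra.adjoin_induction with
    | mem x h =>
      obtain ⟨g, rfl⟩ := h
      refine ⟨Submodule.mem_iSup_of_mem _ (gp_gen_mem R G g), fun y hy => ?_⟩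
      induction hy using Submodule.iSup_induction' with
      | mem j y hy => exact Submodule.mem_iSup_of_mem _ (gp_mul_gen R G j y hy g)
      | zero => simp
      | add y z _ _ hy hz => rw [add_mul]; exact add_mem hy hz
    | zero => simp
    | add x y _ _ hx hy =>
      exact ⟨add_mem hx.1 hy.1, fun z hz => by
        rw [mul_add]; exact add_mem (hx.2 z hz) (hy.2 z hz)⟩
    | mul x y _ _ hx hy =>
      exact ⟨hy.2 _ hx.1, fun z hz => by rw [← mul_assoc]; exact hy.2 _ (hx.2 z hz)⟩
    | smul r x _ hx =>
      exact ⟨Submodule.smul_mem _ _ hx.1, fun z hz => by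
        rw [mul_smul_comm]; exact Submodule.smul_mem _ _ (hx.2 z hz)⟩
  have hmap : (⨆ k : ℤ, component R G k).map (LeavittSubalgebra R G).toSubmodule.subtype
      = ⨆ k : ℤ, gpC R G k := by
    refine (Submodule.map_iSup _ _).trans ?_
    exact iSup_congr fun k => gp_map_component R G k
  rw [eq_top_iff]
  rintro x -
  have hx := (hS x.1 x.2).1
  rw [← hmap] at hx
  obtain ⟨y, hy, hxy⟩ := hx
  have : y = x := Subtype.ext hxy
  exact this ▸ hy

theorem gp_coeff (m : DirectSum ℤ (fun k => component R G k)) (k : ℤ) :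
    (gpHom R G ((DirectSum.coeAddMonoidHom (fun k : ℤ => component R G k) m :
      LeavittPathAlgebra R G) : Ambient R G)).coeff k =
      ((m k : LeavittPathAlgebra R G) : Ambient R G) := by
  classical
  induction m using DirectSum.induction_on with
  | zero => simp
  | of i x =>
    rw [DirectSum.coeAddMonoidHom_of, gpHom_gpC R G i _ ((gp_mem_component R G i _).1 x.2)]
    rw [AddMonoidAlgebra.coeff_single, Finsupp.single_apply]
    split_ifs with h
    · subst h
      rw [DirectSum.of_eq_same]
    · rw [DirectSum.of_eq_of_ne _ _ _ (Ne.symm h)]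
      rfl
  | add x y hx hy =>
    rw [map_add, DirectSum.add_apply]
    simp only [NonUnitalSubalgebra.coe_add, map_add, AddMonoidAlgebra.coeff_add,
      Finsupp.add_apply, hx, hy, Submodule.coe_add]

theorem gp_internal : DirectSum.IsInternal (fun k : ℤ => component R G k) := by
  classical
  constructor
  · intro m n h
    refine DFinsupp.ext fun k => ?_
    apply Subtype.ext
    apply Subtype.ext
    refine (gp_coeff R G m k).symm.trans (Eq.trans ?_ (gp_coeff R G n k))
    rw [h]
  · intro x
    have hx : x ∈ (⨆ k : ℤ, component R G k) := by
      rw [gp_iSup_top]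
      trivial
    induction hx using Submodule.iSup_induction' with
    | mem j y hy =>
      exact ⟨DirectSum.of (fun k : ℤ => component R G k) j ⟨y, hy⟩,
        DirectSum.coeAddMonoidHom_of _ _ _⟩
    | zero => exact ⟨0, map_zero _⟩
    | add y z _ _ hy hz =>
      obtain ⟨a, rfl⟩ := hy
      obtain ⟨b, rfl⟩ := hz
      exact ⟨a + b, map_add _ _ _⟩

end GradingProof

end LPAGraph

open LPAGraph in
/-- **Proposition (the canonical `ℤ`-grading).**  `L_R(E)` is `ℤ`-graded with homogeneous
component of degree `k` equal to the `R`-span of the elements `α β*` with `|α| - |β| = k`: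
the components are independent, sum to everything (i.e. they give an internal direct sum
decomposition), and multiply as `L_j · L_k ⊆ L_{j+k}`. -/
theorem stmt1 (R : Type) [CommRing R] (G : LPAGraph) :
    DirectSum.IsInternal (fun k : ℤ => component R G k) ∧
    (∀ (j k : ℤ), ∀ x ∈ component R G j, ∀ y ∈ component R G k,
      x * y ∈ component R G (j + k)) := by
  refine ⟨?_, ?_⟩
  · exact gp_internal R G
  · intro j k x hx y hy
    rw [gp_mem_component] at hx hy ⊢
    exact gp_mul R G j k _ _ hx hy
end
end

section
/- Let E be a graph and R a commutative ring with unit. Then the set of paths E* is linearly independent over R in L_R(E), and likewise the set of ghost paths {α* : α ∈ E*} is linearly independent over R in L_R(E). -/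
set_option maxHeartbeats 1000000
set_option synthInstance.maxHeartbeats 400000

noncomputable section

namespace LPAGraph

/-- For every graph, the edges can be encoded by injections of `ℕ` into `ℕ`
whose images partition `ℕ` at every non-sink. -/
theorem exists_enc (G : LPAGraph) : ∃ enc : G.E → ℕ → ℕ,
    (∀ e e' n n', G.src e = G.src e' → enc e n = enc e' n' → e = e' ∧ n = n') ∧
    (∀ v n, (∃ e, G.src e = v) → ∃ e m, G.src e = v ∧ enc e m = n) := by
  classical
  have := G.countE
  have key : ∀ v : G.V, (∃ e, G.src e = v) →
      Nonempty (({e : G.E // G.src e = v} × ℕ) ≃ ℕ) := by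
    rintro v ⟨e, he⟩
    have : Nonempty {e : G.E // G.src e = v} := ⟨⟨e, he⟩⟩
    exact nonempty_equiv_of_countable
  choose φ hφ using fun (v : G.V) (h : ∃ e, G.src e = v) =>
    (⟨(key v h).some, trivial⟩ : ∃ _ : ({e : G.E // G.src e = v} × ℕ) ≃ ℕ, True)
  refine ⟨fun e n => φ (G.src e) ⟨e, rfl⟩ (⟨e, rfl⟩, n), ?_, ?_⟩
  · intro e e' n n' hs h
    have gen : ∀ (v : G.V) (hv : G.src e' = v) (he : G.src e = v),
        φ v ⟨e, he⟩ (⟨e, he⟩, n) = φ v ⟨e', hv⟩ (⟨e', hv⟩, n') → e = e' ∧ n = n' := by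
      intro v hv he h
      have := (φ v ⟨e, he⟩).injective h
      simpa using this
    apply gen (G.src e') rfl hs
    have gen2 : ∀ (v : G.V) (he : G.src e = v),
        φ v ⟨e, he⟩ (⟨e, he⟩, n) = φ (G.src e) ⟨e, rfl⟩ (⟨e, rfl⟩, n) := by
      intro v he
      subst he
      rfl
    rw [gen2]
    exact h
  · intro v n hv
    obtain ⟨⟨⟨e, he⟩, m⟩, h⟩ := (φ v hv).surjective n
    subst he
    exact ⟨e, m, rfl, h⟩

section rep

variable (R : Type) [CommRing R] (G : LPAGraph)

/-- The points on which the representation acts. -/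
abbrev Pt : Type := G.V × ℕ × ℤ

open Classical in
/-- The action of a vertex. -/
def vOp (v : G.V) : Module.End R (Pt G → R) where
  toFun h x := if x.1 = v then h x else 0
  map_add' h h' := by
    funext x
    by_cases hx : x.1 = v <;> simp [hx]
  map_smul' c h := by
    funext x
    by_cases hx : x.1 = v <;> simp [hx]

open Classical in
/-- The action of a ghost edge. -/
def gOp (enc : G.E → ℕ → ℕ) (e : G.E) : Module.End R (Pt G → R) where
  toFun h x := if x.1 = G.rng e then h (G.src e, enc e x.2.1, x.2.2 + 1) else 0
  map_add' h h' := by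
    funext x
    by_cases hx : x.1 = G.rng e <;> simp [hx]
  map_smul' c h := by
    funext x
    by_cases hx : x.1 = G.rng e <;> simp [hx]

open Classical in
/-- The action of a real edge. -/
def eOp (enc : G.E → ℕ → ℕ) (e : G.E) : Module.End R (Pt G → R) where
  toFun h x := if H : ∃ m, x.1 = G.src e ∧ enc e m = x.2.1 then
    h (G.rng e, H.choose, x.2.2 - 1) else 0
  map_add' h h' := by
    funext x
    simp only [Pi.add_apply, Pi.smul_apply, RingHom.id_apply]
    split_ifs <;> simp
  map_smul' c h := by
    funext x
    simp only [Pi.add_apply, Pi.smul_apply, RingHom.id_apply]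
    split_ifs <;> simp

open Classical in
theorem vOp_apply (v : G.V) (h : Pt G → R) (x : Pt G) :
    vOp R G v h x = if x.1 = v then h x else 0 := rfl

open Classical in
theorem gOp_apply (enc : G.E → ℕ → ℕ) (e : G.E) (h : Pt G → R) (x : Pt G) :
    gOp R G enc e h x = if x.1 = G.rng e then h (G.src e, enc e x.2.1, x.2.2 + 1) else 0 := rfl

/-- The injectivity part of the encoding. -/
def EncInj (enc : G.E → ℕ → ℕ) : Prop :=
  ∀ e e' n n', G.src e = G.src e' → enc e n = enc e' n' → e = e' ∧ n = n'

open Classical in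
theorem eOp_apply {enc : G.E → ℕ → ℕ} (hi : EncInj G enc) (e e' : G.E) (h : Pt G → R)
    (m : ℕ) (k : ℤ) :
    eOp R G enc e h (G.src e', enc e' m, k) = if e = e' then h (G.rng e, m, k - 1) else 0 := by
  change (dite _ _ _ : R) = _
  split_ifs with H H' H'
  · subst H'
    have := (hi _ _ _ _ rfl H.choose_spec.2).2
    dsimp only at this ⊢
    rw [this]
  · obtain ⟨n, hn, hn'⟩ := H
    exact absurd (hi _ _ _ _ hn.symm hn').1 H'
  · subst H'
    exact absurd ⟨m, rfl, rfl⟩ H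
  · rfl

open Classical in
theorem eOp_apply_of_ne {enc : G.E → ℕ → ℕ} (e : G.E) (h : Pt G → R)
    (x : Pt G) (hx : x.1 ≠ G.src e) : eOp R G enc e h x = 0 := by
  change (dite _ _ _ : R) = _
  rw [dif_neg]
  rintro ⟨m, h1, -⟩
  exact hx h1

open Classical in
theorem eOp_cases {enc : G.E → ℕ → ℕ} (hi : EncInj G enc) (e : G.E) (x : Pt G) :
    (∃ m k, x = (G.src e, enc e m, k)) ∨ ∀ h : Pt G → R, eOp R G enc e h x = 0 := by
  by_cases H : ∃ m, x.1 = G.src e ∧ enc e m = x.2.1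
  · obtain ⟨m, h1, h2⟩ := H
    exact Or.inl ⟨m, x.2.2, by rw [← h1, h2]⟩
  · refine Or.inr fun h => ?_
    change (dite _ _ _ : R) = _
    rw [dif_neg H]

/-- The generators of the representation. -/
def repGen (enc : G.E → ℕ → ℕ) : LGen G → Module.End R (Pt G → R)
  | .vert v => vOp R G v
  | .edge e => eOp R G enc e
  | .ghost e => gOp R G enc e

theorem repGen_rel {enc : G.E → ℕ → ℕ} (hi : EncInj G enc)
    (hs : ∀ v n, (∃ e, G.src e = v) → ∃ e m, G.src e = v ∧ enc e m = n)
    ⦃a b : FreeAlgebra R (LGen G)⦄ (hab : LeavittRel R G a b) :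
    FreeAlgebra.lift R (repGen R G enc) a = FreeAlgebra.lift R (repGen R G enc) b := by
  classical
  induction hab with
  | vert_mul_self v =>
    simp only [map_mul, FreeAlgebra.lift_ι_apply, repGen]
    refine LinearMap.ext fun h => funext fun x => ?_
    simp only [Module.End.mul_apply, vOp_apply]
    split_ifs <;> rfl
  | vert_mul_vert v w hvw =>
    simp only [map_mul, map_zero, FreeAlgebra.lift_ι_apply, repGen]
    refine LinearMap.ext fun h => funext fun x => ?_
    simp only [Module.End.mul_apply, vOp_apply]
    split_ifs with h1 h2
    · exact absurd (h1.symm.trans h2) hvw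
    · rfl
    · rfl
  | src_mul_edge e =>
    simp only [map_mul, FreeAlgebra.lift_ι_apply, repGen]
    refine LinearMap.ext fun h => funext fun x => ?_
    simp only [Module.End.mul_apply, vOp_apply]
    split_ifs with h1
    · rfl
    · rw [eOp_apply_of_ne R G e h x h1]
  | edge_mul_rng e =>
    simp only [map_mul, FreeAlgebra.lift_ι_apply, repGen]
    refine LinearMap.ext fun h => funext fun x => ?_
    simp only [Module.End.mul_apply]
    rcases eOp_cases R G hi e x with ⟨m, k, rfl⟩ | hx
    · simp [eOp_apply R G hi, vOp_apply]
    · rw [hx, hx]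
  | rng_mul_ghost e =>
    simp only [map_mul, FreeAlgebra.lift_ι_apply, repGen]
    refine LinearMap.ext fun h => funext fun x => ?_
    simp only [Module.End.mul_apply, vOp_apply, gOp_apply]
    split_ifs <;> rfl
  | ghost_mul_src e =>
    simp only [map_mul, FreeAlgebra.lift_ι_apply, repGen]
    refine LinearMap.ext fun h => funext fun x => ?_
    simp [Module.End.mul_apply, vOp_apply, gOp_apply]
  | ghost_mul_self e =>
    simp only [map_mul, FreeAlgebra.lift_ι_apply, repGen]
    refine LinearMap.ext fun h => funext fun x => ?_
    simp only [Module.End.mul_apply, vOp_apply, gOp_apply, eOp_apply R G hi]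
    split_ifs with h1
    · simp [← h1]
    · rfl
  | ghost_mul_edge e f hef =>
    simp only [map_mul, map_zero, FreeAlgebra.lift_ι_apply, repGen]
    refine LinearMap.ext fun h => funext fun x => ?_
    simp [Module.End.mul_apply, gOp_apply, eOp_apply R G hi, Ne.symm hef]
  | ck v s hsv hne =>
    simp only [map_sum, map_mul, FreeAlgebra.lift_ι_apply, repGen]
    refine LinearMap.ext fun h => funext fun x => ?_
    simp only [LinearMap.sum_apply, Finset.sum_apply, Module.End.mul_apply, vOp_apply]
    obtain ⟨w, n, k⟩ := x
    split_ifs with h1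
    · dsimp only at h1
      subst h1
      obtain ⟨e0, he0⟩ := hne
      obtain ⟨e, m, rfl, rfl⟩ := hs w n ⟨e0, (hsv e0).1 he0⟩
      simp only [eOp_apply R G hi, gOp_apply]
      rw [Finset.sum_eq_single e]
      · simp
      · intro b _ hb
        simp [hb]
      · intro hb
        exact absurd ((hsv e).2 rfl) hb
    · symm
      apply Finset.sum_eq_zero
      intro e he
      apply eOp_apply_of_ne
      rw [(hsv e).1 he]
      exact h1

/-- The representation. -/
def rep {enc : G.E → ℕ → ℕ} (hi : EncInj G enc)
    (hs : ∀ v n, (∃ e, G.src e = v) → ∃ e m, G.src e = v ∧ enc e m = n) :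
    Ambient R G →ₐ[R] Module.End R (Pt G → R) :=
  RingQuot.liftAlgHom R ⟨FreeAlgebra.lift R (repGen R G enc), repGen_rel R G hi hs⟩

theorem rep_ugen {enc : G.E → ℕ → ℕ} (hi : EncInj G enc)
    (hs : ∀ v n, (∃ e, G.src e = v) → ∃ e m, G.src e = v ∧ enc e m = n) (x : LGen G) :
    rep R G hi hs (ugen R G x) = repGen R G enc x := by
  rw [rep, ugen, RingQuot.liftAlgHom_mkAlgHom_apply]
  simp

/-- Translate a point by a list of edges. -/
def pt (enc : G.E → ℕ → ℕ) : List G.E → Pt G → Pt G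
  | [], y => y
  | e :: es, y => (G.src e, enc e (pt enc es y).2.1, (pt enc es y).2.2 + 1)

theorem pt_fst (enc : G.E → ℕ → ℕ) {u w : G.V} {es : List G.E} (h : IsPathFrom G u es w)
    (y : Pt G) (hy : y.1 = w) : (pt G enc es y).1 = u := by
  cases h with
  | nil => exact hy
  | cons e h ht => exact h

theorem pt_deg (enc : G.E → ℕ → ℕ) (es : List G.E) (y : Pt G) :
    (pt G enc es y).2.2 = y.2.2 + es.length := by
  induction es with
  | nil => simp [pt]
  | cons e es ih => simp [pt, ih, add_assoc]

theorem pt_inj {enc : G.E → ℕ → ℕ} (hi : EncInj G enc) (y : Pt G) (w : G.V) (hy : y.1 = w) :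
    ∀ (es es' : List G.E) (u u' : G.V), IsPathFrom G u es w → IsPathFrom G u' es' w →
      es.length = es'.length → (pt G enc es y).1 = (pt G enc es' y).1 →
      (pt G enc es y).2.1 = (pt G enc es' y).2.1 → es = es'
  | [], [], _, _, _, _, _, _, _ => rfl
  | [], _ :: _, _, _, _, _, h, _, _ => by simp at h
  | _ :: _, [], _, _, _, _, h, _, _ => by simp at h
  | e :: es, e' :: es', u, u', hp, hp', h, h1, h2 => by
    dsimp only [pt] at h1 h2
    obtain ⟨rfl, h3⟩ := hi _ _ _ _ h1 h2
    cases hp with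
    | cons _ hs ht =>
    cases hp' with
    | cons _ hs' ht' =>
    rw [pt_inj hi y w hy es es' _ _ ht ht' (by simpa using h)
      (by rw [pt_fst G enc ht y hy, pt_fst G enc ht' y hy]) h3]

theorem edges_deg {enc : G.E → ℕ → ℕ} (hi : EncInj G enc) (h : Pt G → R) (d : ℤ)
    (hh : ∀ x : Pt G, x.2.2 ≠ d → h x = 0) (es : List G.E) :
    ∀ x : Pt G, x.2.2 ≠ d + es.length → (es.map (eOp R G enc)).prod h x = 0 := by
  induction es with
  | nil => intro x hx; simpa using hh x (by simpa using hx)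
  | cons e es ih =>
    intro x hx
    rw [List.map_cons, List.prod_cons, Module.End.mul_apply]
    rcases eOp_cases R G hi e x with ⟨m, k, rfl⟩ | h0
    · rw [eOp_apply R G hi, if_pos rfl]
      apply ih
      push_cast [List.length_cons] at hx
      dsimp only at hx ⊢
      omega
    · exact h0 _

open Classical in
theorem edges_apply {enc : G.E → ℕ → ℕ} (hi : EncInj G enc) (h : Pt G → R) (y : Pt G) :
    ∀ (es γ : List G.E) (u w : G.V), IsPathFrom G u γ w → y.1 = w → es.length = γ.length →
      (es.map (eOp R G enc)).prod h (pt G enc γ y) = if es = γ then h y else 0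
  | [], [], _, _, _, _, _ => by simp [pt]
  | [], _ :: _, _, _, _, _, h => by simp at h
  | _ :: _, [], _, _, _, _, h => by simp at h
  | e :: es, e' :: γ, u, w, hp, hy, hl => by
    rw [List.map_cons, List.prod_cons, Module.End.mul_apply, pt, eOp_apply R G hi]
    cases hp with
    | cons _ hs ht =>
    by_cases hee : e = e'
    · subst hee
      have ih := edges_apply hi h y es γ _ _ ht hy (by simpa using hl)
      have h1 : ((G.rng e, (pt G enc γ y).2.1, (pt G enc γ y).2.2 + 1 - 1) : Pt G)
          = pt G enc γ y := by
        rw [add_sub_cancel_right, ← pt_fst G enc ht y hy]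
      rw [if_pos rfl, h1, ih]
      simp
    · simp [hee]

open Classical in
theorem ghosts_apply {enc : G.E → ℕ → ℕ} {u w' : G.V} {es : List G.E}
    (hp : IsPathFrom G u es w') (y : Pt G) : ∀ h : Pt G → R,
    ((es.map (gOp R G enc)).reverse.prod) (vOp R G u h) y
      = if y.1 = w' then h (pt G enc es y) else 0 := by
  induction hp with
  | nil v => intro h; simp [vOp_apply, pt]
  | @cons u w e es hs ht ih =>
    intro h
    have h1 : gOp R G enc e (vOp R G u h)
        = vOp R G (G.rng e) (gOp R G enc e (vOp R G u h)) := by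
      funext x
      simp only [vOp_apply, gOp_apply]
      split_ifs <;> rfl
    rw [List.map_cons, List.reverse_cons, List.prod_append, Module.End.mul_apply,
      List.prod_singleton, h1, ih]
    split_ifs with hy
    · rw [gOp_apply, if_pos (pt_fst G enc ht y hy), vOp_apply, if_pos hs]
      rfl
    · rfl

theorem linInd_of_dual {ι M : Type} [AddCommMonoid M] [Module R M] (v : ι → M)
    (f : ι → M →ₗ[R] R) (h1 : ∀ i, f i (v i) = 1) (h0 : ∀ i j, i ≠ j → f i (v j) = 0) :
    LinearIndependent R v := by
  have key : ∀ (c : ι →₀ R) (i : ι), f i (Finsupp.linearCombination R v c) = c i := by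
    intro c i
    rw [Finsupp.linearCombination_apply, Finsupp.sum, map_sum, Finset.sum_eq_single i]
    · simp [h1]
    · intro j _ hj
      simp [h0 i j hj.symm]
    · intro h
      simp [Finsupp.notMem_support_iff.1 h]
  intro a b hab
  ext i
  rw [← key a i, ← key b i, hab]

/-- Matrix coefficients of the representation. -/
def coeffFun (ρ : Ambient R G →ₐ[R] Module.End R (Pt G → R)) (h : Pt G → R) (x : Pt G) :
    LeavittPathAlgebra R G →ₗ[R] R where
  toFun a := ρ (a : Ambient R G) h x
  map_add' a b := by simp
  map_smul' c a := by simp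

theorem coeffFun_path (ρ : Ambient R G →ₐ[R] Module.End R (Pt G → R)) (h : Pt G → R) (x : Pt G)
    (u : G.V) (es : List G.E) :
    coeffFun R G ρ h x (pathElem R G u es) = ρ (uPath R G u es) h x := rfl

theorem coeffFun_ghost (ρ : Ambient R G →ₐ[R] Module.End R (Pt G → R)) (h : Pt G → R) (x : Pt G)
    (u : G.V) (es : List G.E) :
    coeffFun R G ρ h x (ghostPathElem R G u es) = ρ (uGhostPath R G u es) h x := rfl

end rep

end LPAGraph

open LPAGraph in
/-- **Proposition (linear independence of paths).**  The set of paths `E*` in `L_R(E)` is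
linearly independent over `R`, and likewise the set of ghost paths `{α* : α ∈ E*}` is linearly
independent over `R`.  (A path is encoded by its source vertex together with its list of
edges; distinct such pairs give distinct paths.) -/
theorem stmt2 (R : Type) [CommRing R] (G : LPAGraph) :
    LinearIndependent R
      (fun p : {p : G.V × List G.E // ∃ w : G.V, IsPathFrom G p.1 p.2 w} =>
        pathElem R G p.1.1 p.1.2) ∧
    LinearIndependent R
      (fun p : {p : G.V × List G.E // ∃ w : G.V, IsPathFrom G p.1 p.2 w} =>
        ghostPathElem R G p.1.1 p.1.2) := by
  classical
  obtain ⟨enc, hi, hs⟩ := exists_enc G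
  replace hi : EncInj G enc := hi
  have hpath : ∀ u es, rep R G hi hs (uPath R G u es)
      = vOp R G u * (es.map (eOp R G enc)).prod := by
    intro u es
    rw [uPath, map_mul, rep_ugen, map_list_prod, List.map_map]
    congr 3
    funext e
    exact rep_ugen R G hi hs _
  have hghost : ∀ u es, rep R G hi hs (uGhostPath R G u es)
      = (es.map (gOp R G enc)).reverse.prod * vOp R G u := by
    intro u es
    rw [uGhostPath, map_mul, rep_ugen, map_list_prod, List.map_reverse, List.map_map]
    congr 4
    funext e
    exact rep_ugen R G hi hs _
  constructor
  · refine linInd_of_dual R _ (fun p => coeffFun R G (rep R G hi hs)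
      (Pi.single (p.2.choose, 0, 0) 1) (pt G enc p.1.2 (p.2.choose, 0, 0))) ?_ ?_
    · rintro ⟨⟨u, es⟩, hp⟩
      dsimp only
      rw [coeffFun_path]
      rw [hpath, Module.End.mul_apply, vOp_apply, if_pos (pt_fst G enc hp.choose_spec _ rfl),
        edges_apply R G hi _ _ _ _ _ _ hp.choose_spec rfl rfl]
      simp
    · rintro ⟨⟨u, es⟩, hp⟩ ⟨⟨u', es'⟩, hp'⟩ hne
      dsimp only
      rw [coeffFun_path]
      rw [hpath, Module.End.mul_apply, vOp_apply, pt_fst G enc hp.choose_spec _ rfl]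
      split_ifs with huu
      · subst huu
        by_cases hl : es'.length = es.length
        · rw [edges_apply R G hi _ _ _ _ _ _ hp.choose_spec rfl hl, if_neg]
          rintro rfl
          exact hne rfl
        · apply edges_deg R G hi _ 0
          · intro x hx
            apply Pi.single_eq_of_ne
            rintro rfl
            exact hx rfl
          · rw [pt_deg]
            dsimp only
            omega
      · rfl
  · refine linInd_of_dual R _ (fun p => coeffFun R G (rep R G hi hs)
      (Pi.single (pt G enc p.1.2 (p.2.choose, 0, 0)) 1) (p.2.choose, 0, 0)) ?_ ?_
    · rintro ⟨⟨u, es⟩, hp⟩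
      dsimp only
      rw [coeffFun_ghost]
      rw [hghost, Module.End.mul_apply, ghosts_apply R G hp.choose_spec, if_pos rfl]
      simp
    · rintro ⟨⟨u, es⟩, hp⟩ ⟨⟨u', es'⟩, hp'⟩ hne
      dsimp only
      rw [coeffFun_ghost]
      obtain ⟨w', hw'⟩ := hp'
      rw [hghost, Module.End.mul_apply, ghosts_apply R G hw']
      split_ifs with hww
      · apply Pi.single_eq_of_ne
        intro heq
        dsimp only at heq hww
        have hlen : es'.length = es.length := by
          have hd := congrArg (fun x : Pt G => x.2.2) heq
          simp only [pt_deg] at hd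
          omega
        have h1 : (pt G enc es' (hp.choose, 0, 0)).1 = (pt G enc es (hp.choose, 0, 0)).1 :=
          congrArg (fun x : Pt G => x.1) heq
        have h2 : (pt G enc es' (hp.choose, 0, 0)).2.1 = (pt G enc es (hp.choose, 0, 0)).2.1 :=
          congrArg (fun x : Pt G => x.2.1) heq
        have hes : es' = es := pt_inj G hi (hp.choose, 0, 0) hp.choose rfl es' es u' u
          (by rw [hww]; exact hw') hp.choose_spec hlen h1 h2
        rw [pt_fst G enc hw' (hp.choose, 0, 0) hww,
          pt_fst G enc hp.choose_spec (hp.choose, 0, 0) rfl] at h1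
        subst hes
        subst h1
        exact hne rfl
      · rfl
end
end

section
/- Let E be a graph, R a commutative ring with unit, and let I be a graded ideal of L_R(E) (with respect to the canonical Z-grading). Then I is generated as an ideal by the set I₀ := I ∩ L_R(E)₀. -/
set_option maxHeartbeats 1000000
set_option synthInstance.maxHeartbeats 400000

noncomputable section

namespace LPAGraph

theorem hx_vert_src (R : Type) [CommRing R] (G : LPAGraph) (e : G.E) :
    ugen R G (LGen.vert (G.src e)) * ugen R G (LGen.edge e) = ugen R G (LGen.edge e) := by
  simpa [ugen] using RingQuot.mkAlgHom_rel R (LeavittRel.src_mul_edge (R := R) e)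

theorem hx_edge_rng (R : Type) [CommRing R] (G : LPAGraph) (e : G.E) :
    ugen R G (LGen.edge e) * ugen R G (LGen.vert (G.rng e)) = ugen R G (LGen.edge e) := by
  simpa [ugen] using RingQuot.mkAlgHom_rel R (LeavittRel.edge_mul_rng (R := R) e)

theorem hx_rng_ghost (R : Type) [CommRing R] (G : LPAGraph) (e : G.E) :
    ugen R G (LGen.vert (G.rng e)) * ugen R G (LGen.ghost e) = ugen R G (LGen.ghost e) := by
  simpa [ugen] using RingQuot.mkAlgHom_rel R (LeavittRel.rng_mul_ghost (R := R) e)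

theorem hx_ghost_src (R : Type) [CommRing R] (G : LPAGraph) (e : G.E) :
    ugen R G (LGen.ghost e) * ugen R G (LGen.vert (G.src e)) = ugen R G (LGen.ghost e) := by
  simpa [ugen] using RingQuot.mkAlgHom_rel R (LeavittRel.ghost_mul_src (R := R) e)

theorem hx_vert_idem (R : Type) [CommRing R] (G : LPAGraph) (v : G.V) :
    ugen R G (LGen.vert v) * ugen R G (LGen.vert v) = ugen R G (LGen.vert v) := by
  simpa [ugen] using RingQuot.mkAlgHom_rel R (LeavittRel.vert_mul_self (R := R) v)

theorem hx_ghost_edge (R : Type) [CommRing R] (G : LPAGraph) (e : G.E) :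
    ugen R G (LGen.ghost e) * ugen R G (LGen.edge e) = ugen R G (LGen.vert (G.rng e)) := by
  simpa [ugen] using RingQuot.mkAlgHom_rel R (LeavittRel.ghost_mul_self (R := R) e)

theorem hx_ghost_edge_ne (R : Type) [CommRing R] (G : LPAGraph) (e f : G.E) (h : e ≠ f) :
    ugen R G (LGen.ghost e) * ugen R G (LGen.edge f) = 0 := by
  simpa [ugen] using RingQuot.mkAlgHom_rel R (LeavittRel.ghost_mul_edge (R := R) e f h)

theorem hx_path_cons (R : Type) [CommRing R] (G : LPAGraph) (e : G.E) (es : List G.E) :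
    pathElem R G (G.src e) (e :: es) = edgeElem R G e * pathElem R G (G.rng e) es := by
  apply Subtype.ext
  change uPath R G _ _ = ugen R G _ * uPath R G _ _
  simp only [uPath, List.map_cons, List.prod_cons]
  rw [← mul_assoc, ← mul_assoc, hx_vert_src, hx_edge_rng]

theorem hx_ghost_cons (R : Type) [CommRing R] (G : LPAGraph) (e : G.E) (es : List G.E) :
    ghostPathElem R G (G.src e) (e :: es) =
      ghostPathElem R G (G.rng e) es * ghostElem R G e := by
  apply Subtype.ext
  change uGhostPath R G _ _ = uGhostPath R G _ _ * ugen R G _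
  simp only [uGhostPath, List.map_cons, List.reverse_cons, List.prod_append, List.prod_singleton]
  rw [mul_assoc, mul_assoc, hx_ghost_src, hx_rng_ghost]

theorem hx_ghost_edge_path (R : Type) [CommRing R] (G : LPAGraph) (e : G.E) (es : List G.E) :
    ghostElem R G e * (edgeElem R G e * pathElem R G (G.rng e) es) =
      pathElem R G (G.rng e) es := by
  apply Subtype.ext
  change ugen R G _ * (ugen R G _ * uPath R G _ _) = uPath R G _ _
  rw [← mul_assoc, hx_ghost_edge, uPath, ← mul_assoc, hx_vert_idem]

theorem hx_ghostpath_edge (R : Type) [CommRing R] (G : LPAGraph) (e : G.E) (es : List G.E) :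
    ghostPathElem R G (G.rng e) es * ghostElem R G e * edgeElem R G e =
      ghostPathElem R G (G.rng e) es := by
  apply Subtype.ext
  change uGhostPath R G _ _ * ugen R G _ * ugen R G _ = uGhostPath R G _ _
  rw [mul_assoc, hx_ghost_edge, uGhostPath, mul_assoc, hx_vert_idem]

theorem hx_ne (R : Type) [CommRing R] (G : LPAGraph) (e f : G.E) (h : e ≠ f) :
    ghostElem R G e * edgeElem R G f = 0 :=
  Subtype.ext (hx_ghost_edge_ne R G e f h)

/-- Multiplication by a ghost edge on the left lowers a positive degree by one. -/
theorem hx_lower (R : Type) [CommRing R] (G : LPAGraph) (k : ℕ) (f : G.E)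
    (x : LeavittPathAlgebra R G) (hx : x ∈ component R G ((k : ℤ) + 1)) :
    ghostElem R G f * x ∈ component R G (k : ℤ) := by
  induction hx using Submodule.span_induction with
  | zero => rw [mul_zero]; exact zero_mem _
  | add x y _ _ ihx ihy => rw [mul_add]; exact add_mem ihx ihy
  | smul a x _ ih => rw [mul_smul_comm]; exact Submodule.smul_mem _ _ ih
  | mem x h =>
    obtain ⟨u, es, u', es', w, h1, h2, hk, rfl⟩ := h
    cases h1 with
    | nil => simp at hk; omega
    | cons e he ht =>
      subst he
      rw [hx_path_cons]
      by_cases hef : f = e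
      · subst hef
        rw [← mul_assoc, hx_ghost_edge_path]
        refine Submodule.subset_span ⟨_, _, _, _, _, ht, h2, ?_, rfl⟩
        simp at hk; omega
      · rw [← mul_assoc, ← mul_assoc, hx_ne R G f e hef, zero_mul, zero_mul]
        exact zero_mem _

theorem hx_raise (R : Type) [CommRing R] (G : LPAGraph) (k : ℕ) (f : G.E)
    (x : LeavittPathAlgebra R G) (hx : x ∈ component R G (-((k : ℤ) + 1))) :
    x * edgeElem R G f ∈ component R G (-(k : ℤ)) := by
  induction hx using Submodule.span_induction with
  | zero => rw [zero_mul]; exact zero_mem _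
  | add x y _ _ ihx ihy => rw [add_mul]; exact add_mem ihx ihy
  | smul a x _ ih => rw [smul_mul_assoc]; exact Submodule.smul_mem _ _ ih
  | mem x h =>
    obtain ⟨u, es, u', es', w, h1, h2, hk, rfl⟩ := h
    cases h2 with
    | nil => simp at hk; omega
    | cons e he ht =>
      subst he
      rw [hx_ghost_cons]
      by_cases hef : e = f
      · subst hef
        rw [mul_assoc, hx_ghostpath_edge]
        refine Submodule.subset_span ⟨_, _, _, _, _, h1, ht, ?_, rfl⟩
        simp at hk; omega
      · rw [mul_assoc, mul_assoc, hx_ne R G e f hef, mul_zero, mul_zero]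
        exact zero_mem _

open scoped Classical in
theorem hx_expand_left (R : Type) [CommRing R] (G : LPAGraph) (k : ℕ)
    (x : LeavittPathAlgebra R G) (hx : x ∈ component R G ((k : ℤ) + 1)) :
    ∃ F₀ : Finset G.E, ∀ F, F₀ ⊆ F →
      ∑ e ∈ F, edgeElem R G e * (ghostElem R G e * x) = x := by
  induction hx using Submodule.span_induction with
  | zero => exact ⟨∅, fun F _ => by simp⟩
  | add x y _ _ ihx ihy =>
    obtain ⟨A, hA⟩ := ihx
    obtain ⟨B, hB⟩ := ihy
    refine ⟨A ∪ B, fun F hF => ?_⟩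
    simp only [mul_add, Finset.sum_add_distrib]
    rw [hA F (Finset.union_subset_left hF), hB F (Finset.union_subset_right hF)]
  | smul a x _ ih =>
    obtain ⟨A, hA⟩ := ih
    refine ⟨A, fun F hF => ?_⟩
    simp only [mul_smul_comm, ← Finset.smul_sum]
    rw [hA F hF]
  | mem x h =>
    obtain ⟨u, es, u', es', w, h1, h2, hk, rfl⟩ := h
    cases h1 with
    | nil => simp at hk; omega
    | cons e he ht =>
      subst he
      refine ⟨{e}, fun F hF => ?_⟩
      rw [hx_path_cons, Finset.sum_eq_single_of_mem e (hF (Finset.mem_singleton_self e))]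
      · rw [← mul_assoc (ghostElem R G e), hx_ghost_edge_path, ← mul_assoc]
      · intro f _ hf
        rw [← mul_assoc (ghostElem R G f), ← mul_assoc (ghostElem R G f), hx_ne R G f e hf,
          zero_mul, zero_mul, mul_zero]

open scoped Classical in
theorem hx_expand_right (R : Type) [CommRing R] (G : LPAGraph) (k : ℕ)
    (x : LeavittPathAlgebra R G) (hx : x ∈ component R G (-((k : ℤ) + 1))) :
    ∃ F₀ : Finset G.E, ∀ F, F₀ ⊆ F →
      ∑ e ∈ F, (x * edgeElem R G e) * ghostElem R G e = x := by
  induction hx using Submodule.span_induction with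
  | zero => exact ⟨∅, fun F _ => by simp⟩
  | add x y _ _ ihx ihy =>
    obtain ⟨A, hA⟩ := ihx
    obtain ⟨B, hB⟩ := ihy
    refine ⟨A ∪ B, fun F hF => ?_⟩
    simp only [add_mul, Finset.sum_add_distrib]
    rw [hA F (Finset.union_subset_left hF), hB F (Finset.union_subset_right hF)]
  | smul a x _ ih =>
    obtain ⟨A, hA⟩ := ih
    refine ⟨A, fun F hF => ?_⟩
    simp only [smul_mul_assoc, ← Finset.smul_sum]
    rw [hA F hF]
  | mem x h =>
    obtain ⟨u, es, u', es', w, h1, h2, hk, rfl⟩ := h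
    cases h2 with
    | nil => simp at hk; omega
    | cons e he ht =>
      subst he
      refine ⟨{e}, fun F hF => ?_⟩
      rw [hx_ghost_cons, Finset.sum_eq_single_of_mem e (hF (Finset.mem_singleton_self e))]
      · rw [mul_assoc _ _ (edgeElem R G e), hx_ghostpath_edge, mul_assoc]
      · intro f _ hf
        rw [mul_assoc _ _ (edgeElem R G f), mul_assoc _ _ (edgeElem R G f),
          hx_ne R G e f (Ne.symm hf), mul_zero, mul_zero, zero_mul]

theorem hx_pos (R : Type) [CommRing R] (G : LPAGraph)
    (I J : TwoSidedIdeal (LeavittPathAlgebra R G))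
    (hJ : ∀ x ∈ I, x ∈ component R G 0 → x ∈ J) (k : ℕ) :
    ∀ x ∈ I, x ∈ component R G (k : ℤ) → x ∈ J := by
  induction k with
  | zero => simpa using hJ
  | succ k ih =>
    intro x hxI hx
    rw [Nat.cast_succ] at hx
    obtain ⟨F, hF⟩ := hx_expand_left R G k x hx
    rw [← hF F (Finset.Subset.refl F)]
    exact sum_mem fun e _ => J.mul_mem_left _ _
      (ih _ (I.mul_mem_left _ _ hxI) (hx_lower R G k e x hx))

theorem hx_neg (R : Type) [CommRing R] (G : LPAGraph)
    (I J : TwoSidedIdeal (LeavittPathAlgebra R G))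
    (hJ : ∀ x ∈ I, x ∈ component R G 0 → x ∈ J) (k : ℕ) :
    ∀ x ∈ I, x ∈ component R G (-(k : ℤ)) → x ∈ J := by
  induction k with
  | zero => simpa using hJ
  | succ k ih =>
    intro x hxI hx
    rw [Nat.cast_succ] at hx
    obtain ⟨F, hF⟩ := hx_expand_right R G k x hx
    rw [← hF F (Finset.Subset.refl F)]
    exact sum_mem fun e _ => J.mul_mem_right _ _
      (ih _ (I.mul_mem_right _ _ hxI) (hx_raise R G k e x hx))

end LPAGraph

open LPAGraph in
/-- **Lemma.**  A graded ideal `I` of `L_R(E)` is generated as a (two-sided) ideal by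
`I₀ = I ∩ L_R(E)₀`. -/
theorem stmt3 (R : Type) [CommRing R] (G : LPAGraph)
    (I : TwoSidedIdeal (LeavittPathAlgebra R G)) (hI : IsGradedIdeal R G I) :
    I = TwoSidedIdeal.span
      ((I : Set (LeavittPathAlgebra R G)) ∩ (component R G 0 : Set (LeavittPathAlgebra R G))) := by
  apply le_antisymm
  · intro x hx
    obtain ⟨n, c, hc, rfl⟩ := hI x hx
    refine sum_mem fun i _ => ?_
    obtain ⟨hci, k, hk⟩ := hc i
    have h0 : ∀ y ∈ I, y ∈ component R G 0 → y ∈ TwoSidedIdeal.span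
        ((I : Set (LeavittPathAlgebra R G)) ∩
          (component R G 0 : Set (LeavittPathAlgebra R G))) :=
      fun y hy hy0 => TwoSidedIdeal.subset_span ⟨hy, hy0⟩
    obtain ⟨m, rfl | rfl⟩ := k.eq_nat_or_neg
    · exact hx_pos R G I _ h0 m _ hci hk
    · exact hx_neg R G I _ h0 m _ hci hk
  · rw [TwoSidedIdeal.span_le]
    exact fun x hx => hx.1
end
end

section
/- Let E be a graph and R a commutative ring with unit. If x ∈ L_R(E)₀ (the degree-zero homogeneous component) and x ≠ 0, then there exist paths α, β ∈ E* such that α* x β = r·v for some vertex v ∈ E⁰ and some r ∈ R \ {0}. -/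
set_option maxHeartbeats 1000000
set_option synthInstance.maxHeartbeats 400000

noncomputable section

namespace LPAGraph

section Helpers

variable (R : Type) [CommRing R] (G : LPAGraph)

/-- vertex in the ambient algebra -/
def uV (v : G.V) : Ambient R G := ugen R G (LGen.vert v)
/-- edge in the ambient algebra -/
def uE (e : G.E) : Ambient R G := ugen R G (LGen.edge e)
/-- ghost edge in the ambient algebra -/
def uG (e : G.E) : Ambient R G := ugen R G (LGen.ghost e)

theorem uV_self (v : G.V) : uV R G v * uV R G v = uV R G v := by
  have := RingQuot.mkAlgHom_rel R (LeavittRel.vert_mul_self (R := R) (G := G) v)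
  rwa [map_mul] at this

theorem uV_ne {v w : G.V} (h : v ≠ w) : uV R G v * uV R G w = 0 := by
  have := RingQuot.mkAlgHom_rel R (LeavittRel.vert_mul_vert (R := R) (G := G) v w h)
  rwa [map_mul, map_zero] at this

theorem src_uE (e : G.E) : uV R G (G.src e) * uE R G e = uE R G e := by
  have := RingQuot.mkAlgHom_rel R (LeavittRel.src_mul_edge (R := R) (G := G) e)
  rwa [map_mul] at this

theorem uE_rng (e : G.E) : uE R G e * uV R G (G.rng e) = uE R G e := by
  have := RingQuot.mkAlgHom_rel R (LeavittRel.edge_mul_rng (R := R) (G := G) e)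
  rwa [map_mul] at this

theorem rng_uG (e : G.E) : uV R G (G.rng e) * uG R G e = uG R G e := by
  have := RingQuot.mkAlgHom_rel R (LeavittRel.rng_mul_ghost (R := R) (G := G) e)
  rwa [map_mul] at this

theorem uG_src (e : G.E) : uG R G e * uV R G (G.src e) = uG R G e := by
  have := RingQuot.mkAlgHom_rel R (LeavittRel.ghost_mul_src (R := R) (G := G) e)
  rwa [map_mul] at this

theorem uG_uE_self (e : G.E) : uG R G e * uE R G e = uV R G (G.rng e) := by
  have := RingQuot.mkAlgHom_rel R (LeavittRel.ghost_mul_self (R := R) (G := G) e)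
  rwa [map_mul] at this

theorem uG_uE_ne {e f : G.E} (h : e ≠ f) : uG R G e * uE R G f = 0 := by
  have := RingQuot.mkAlgHom_rel R (LeavittRel.ghost_mul_edge (R := R) (G := G) e f h)
  rwa [map_mul, map_zero] at this

theorem uV_ck (v : G.V) (s : Finset G.E) (hs : ∀ e : G.E, e ∈ s ↔ G.src e = v)
    (hne : s.Nonempty) : uV R G v = ∑ e ∈ s, uE R G e * uG R G e := by
  have := RingQuot.mkAlgHom_rel R (LeavittRel.ck (R := R) (G := G) v s hs hne)
  simp only [map_sum, map_mul] at this
  exact this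

theorem uV_uE_ne {v : G.V} {e : G.E} (h : v ≠ G.src e) : uV R G v * uE R G e = 0 := by
  rw [← src_uE, ← mul_assoc, uV_ne R G h, zero_mul]

theorem uG_uV_ne {v : G.V} {e : G.E} (h : G.src e ≠ v) : uG R G e * uV R G v = 0 := by
  rw [← uG_src, mul_assoc, uV_ne R G h, mul_zero]

/-- filtration of the degree zero part -/
def FF : ℕ → Submodule R (Ambient R G)
  | 0 => Submodule.span R (Set.range (uV R G))
  | n + 1 => Submodule.span R (Set.range (uV R G)) ⊔
      Submodule.span R {x | ∃ e f, ∃ y ∈ FF n, x = uE R G e * y * uG R G f}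

/-- the part with positive length -/
def NN (n : ℕ) : Submodule R (Ambient R G) :=
  Submodule.span R {x | ∃ e f, ∃ y ∈ FF R G n, x = uE R G e * y * uG R G f}

theorem FF_succ (n : ℕ) : FF R G (n + 1) = FF R G 0 ⊔ NN R G n := rfl

theorem uV_mem_FF (n : ℕ) (v : G.V) : uV R G v ∈ FF R G n := by
  have h : uV R G v ∈ FF R G 0 := Submodule.subset_span ⟨v, rfl⟩
  cases n with
  | zero => exact h
  | succ n => rw [FF_succ]; exact Submodule.mem_sup_left h

theorem FF_mono_succ (n : ℕ) : FF R G n ≤ FF R G (n + 1) := by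
  induction n with
  | zero => rw [FF_succ]; exact le_sup_left
  | succ n ih =>
    rw [FF_succ, FF_succ R G (n + 1)]
    refine sup_le_sup le_rfl (Submodule.span_mono ?_)
    rintro x ⟨e, f, y, hy, rfl⟩
    exact ⟨e, f, y, ih hy, rfl⟩

theorem FF_mono : Monotone (FF R G) := monotone_nat_of_le_succ (FF_mono_succ R G)

theorem edge_mem_FF (n : ℕ) (e f : G.E) {y} (hy : y ∈ FF R G n) :
    uE R G e * y * uG R G f ∈ NN R G n := Submodule.subset_span ⟨e, f, y, hy, rfl⟩

theorem FF_zero_induction {p : Ambient R G → Prop} (hv : ∀ v, p (uV R G v)) (h0 : p 0)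
    (hadd : ∀ x y, p x → p y → p (x + y)) (hs : ∀ (r : R) x, p x → p (r • x)) :
    ∀ x ∈ FF R G 0, p x := by
  intro x hx
  induction hx using Submodule.span_induction with
  | mem x h => obtain ⟨v, rfl⟩ := h; exact hv v
  | zero => exact h0
  | add x y _ _ hx hy => exact hadd x y hx hy
  | smul r x _ hx => exact hs r x hx

theorem NN_induction {n : ℕ} {p : Ambient R G → Prop}
    (hv : ∀ e f, ∀ y ∈ FF R G n, p (uE R G e * y * uG R G f)) (h0 : p 0)
    (hadd : ∀ x y, p x → p y → p (x + y)) (hs : ∀ (r : R) x, p x → p (r • x)) :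
    ∀ x ∈ NN R G n, p x := by
  intro x hx
  induction hx using Submodule.span_induction with
  | mem x h => obtain ⟨e, f, y, hy, rfl⟩ := h; exact hv e f y hy
  | zero => exact h0
  | add x y _ _ hx hy => exact hadd x y hx hy
  | smul r x _ hx => exact hs r x hx

theorem FF_induction {p : ℕ → Ambient R G → Prop} (hv : ∀ n v, p n (uV R G v)) (h0 : ∀ n, p n 0)
    (he : ∀ n e f, ∀ y ∈ FF R G n, p (n + 1) (uE R G e * y * uG R G f))
    (hadd : ∀ n x y, p n x → p n y → p n (x + y)) (hs : ∀ n (r : R) x, p n x → p n (r • x)) :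
    ∀ n, ∀ x ∈ FF R G n, p n x := by
  intro n x hx
  cases n with
  | zero => exact FF_zero_induction R G (hv 0) (h0 0) (hadd 0) (hs 0) x hx
  | succ n =>
    rw [FF_succ] at hx
    obtain ⟨y, hy, z, hz, rfl⟩ := Submodule.mem_sup.1 hx
    refine hadd _ _ _ ?_ ?_
    · exact FF_zero_induction R G (hv _) (h0 _) (hadd _) (hs _) y hy
    · exact NN_induction R G (he n) (h0 _) (hadd _) (hs _) z hz

theorem NN_le (n : ℕ) : NN R G n ≤ FF R G (n + 1) := by rw [FF_succ]; exact le_sup_right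

theorem FF_corner_left (a : G.V) : ∀ n, ∀ x ∈ FF R G n, uV R G a * x ∈ FF R G n := by
  refine FF_induction R G ?_ ?_ ?_ ?_ ?_
  · intro n v
    by_cases h : a = v
    · subst h; rw [uV_self]; exact uV_mem_FF R G n a
    · rw [uV_ne R G h]; exact zero_mem _
  · intro n; rw [mul_zero]; exact zero_mem _
  · intro n e f y hy
    by_cases h : a = G.src e
    · subst h
      rw [← mul_assoc, ← mul_assoc, src_uE]
      exact NN_le R G n (edge_mem_FF R G n e f hy)
    · rw [← mul_assoc, ← mul_assoc, uV_uE_ne R G h, zero_mul, zero_mul]; exact zero_mem _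
  · intro n x y hx hy; rw [mul_add]; exact add_mem hx hy
  · intro n r x hx; rw [mul_smul_comm]; exact Submodule.smul_mem _ _ hx

theorem FF_corner_right (a : G.V) : ∀ n, ∀ x ∈ FF R G n, x * uV R G a ∈ FF R G n := by
  refine FF_induction R G ?_ ?_ ?_ ?_ ?_
  · intro n v
    by_cases h : v = a
    · subst h; rw [uV_self]; exact uV_mem_FF R G n v
    · rw [uV_ne R G h]; exact zero_mem _
  · intro n; rw [zero_mul]; exact zero_mem _
  · intro n e f y hy
    by_cases h : G.src f = a
    · subst h
      rw [mul_assoc, uG_src]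
      exact NN_le R G n (edge_mem_FF R G n e f hy)
    · rw [mul_assoc, uG_uV_ne R G h, mul_zero]; exact zero_mem _
  · intro n x y hx hy; rw [add_mul]; exact add_mem hx hy
  · intro n r x hx; rw [smul_mul_assoc]; exact Submodule.smul_mem _ _ hx

theorem FF_compress (n : ℕ) (e f : G.E) :
    ∀ x ∈ NN R G n, uG R G e * x * uE R G f ∈ FF R G n := by
  refine NN_induction R G ?_ ?_ ?_ ?_
  · intro e' f' y hy
    have hre : uG R G e * (uE R G e' * y * uG R G f') * uE R G f
        = (uG R G e * uE R G e') * y * (uG R G f' * uE R G f) := by simp only [mul_assoc]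
    rw [hre]
    by_cases h : e = e'
    · by_cases h' : f' = f
      · subst h h'
        rw [uG_uE_self, uG_uE_self]
        exact FF_corner_right R G _ _ _ (FF_corner_left R G _ _ _ hy)
      · rw [uG_uE_ne R G h', mul_zero]; exact zero_mem _
    · rw [uG_uE_ne R G h, zero_mul, zero_mul]; exact zero_mem _
  · simp
  · intro x y hx hy; rw [mul_add, add_mul]; exact add_mem hx hy
  · intro r x hx; rw [mul_smul_comm, smul_mul_assoc]; exact Submodule.smul_mem _ _ hx

/-- decomposition of a corner, level zero -/
theorem corner_zero (a b : G.V) : ∀ x ∈ FF R G 0, ∃ r : R,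
    uV R G a * x * uV R G b = r • uV R G a ∧ (a ≠ b → r = 0) := by
  refine FF_zero_induction R G ?_ ?_ ?_ ?_
  · intro v
    by_cases h : a = v
    · subst h
      by_cases h' : a = b
      · subst h'
        exact ⟨1, by rw [uV_self, uV_self, one_smul], by simp⟩
      · exact ⟨0, by rw [uV_self, uV_ne R G h', zero_smul], by simp⟩
    · exact ⟨0, by rw [uV_ne R G h, zero_mul, zero_smul], by simp⟩
  · exact ⟨0, by simp, by simp⟩
  · rintro x y ⟨r, hr, hr'⟩ ⟨s, hs, hs'⟩
    exact ⟨r + s, by rw [mul_add, add_mul, hr, hs, add_smul],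
      fun h => by rw [hr' h, hs' h, add_zero]⟩
  · rintro t x ⟨r, hr, hr'⟩
    exact ⟨t * r, by rw [mul_smul_comm, smul_mul_assoc, hr, mul_smul],
      fun h => by rw [hr' h, mul_zero]⟩

theorem NN_corner (n : ℕ) (a b : G.V) : ∀ x ∈ NN R G n,
    uV R G a * x * uV R G b ∈ NN R G n := by
  refine NN_induction R G ?_ ?_ ?_ ?_
  · intro e f y hy
    have hre : uV R G a * (uE R G e * y * uG R G f) * uV R G b
        = (uV R G a * uE R G e) * y * (uG R G f * uV R G b) := by simp only [mul_assoc]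
    rw [hre]
    by_cases h : a = G.src e
    · by_cases h' : G.src f = b
      · subst h h'
        rw [src_uE, uG_src]
        exact edge_mem_FF R G n e f hy
      · rw [uG_uV_ne R G h', mul_zero]; exact zero_mem _
    · rw [uV_uE_ne R G h, zero_mul, zero_mul]; exact zero_mem _
  · simp
  · intro x y hx hy; rw [mul_add, add_mul]; exact add_mem hx hy
  · intro r x hx; rw [mul_smul_comm, smul_mul_assoc]; exact Submodule.smul_mem _ _ hx

theorem regular_mem_NN (n : ℕ) (a : G.V) (ha : G.Regular a) : uV R G a ∈ NN R G n := by
  obtain ⟨hf, hn⟩ := ha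
  rw [uV_ck R G a hf.toFinset (by simp) (by simpa using hn)]
  refine sum_mem fun e _ => ?_
  rw [← uE_rng]
  exact edge_mem_FF R G n e e (uV_mem_FF R G n _)

theorem corner_succ (n : ℕ) (a b : G.V) (x) (hx : x ∈ FF R G (n + 1)) : ∃ r : R, ∃ z ∈ NN R G n,
    uV R G a * x * uV R G b = r • uV R G a + z ∧ (r ≠ 0 → a = b ∧ ¬ G.Regular a) := by
  rw [FF_succ] at hx
  obtain ⟨y, hy, z, hz, rfl⟩ := Submodule.mem_sup.1 hx
  obtain ⟨r, hr, hr'⟩ := corner_zero R G a b y hy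
  have hz' := NN_corner R G n a b z hz
  by_cases ha : G.Regular a
  · refine ⟨0, _, add_mem (Submodule.smul_mem _ r (regular_mem_NN R G n a ha)) hz', ?_, by simp⟩
    rw [mul_add, add_mul, hr, zero_smul, zero_add]
  · refine ⟨r, _, hz', ?_, fun h => ⟨?_, ha⟩⟩
    · rw [mul_add, add_mul, hr]
    · by_contra h'; exact h (hr' h')

/-- finite sum of edge projections -/
def pp (S : Finset G.E) : Ambient R G := ∑ e ∈ S, uE R G e * uG R G e

theorem pp_uE {S : Finset G.E} {e : G.E} (h : e ∈ S) : pp R G S * uE R G e = uE R G e := by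
  rw [pp, Finset.sum_mul, Finset.sum_eq_single_of_mem e h]
  · rw [mul_assoc, uG_uE_self, uE_rng]
  · intro f _ hf
    rw [mul_assoc, uG_uE_ne R G hf, mul_zero]

theorem uG_pp {S : Finset G.E} {e : G.E} (h : e ∈ S) : uG R G e * pp R G S = uG R G e := by
  rw [pp, Finset.mul_sum, Finset.sum_eq_single_of_mem e h]
  · rw [← mul_assoc, uG_uE_self, rng_uG]
  · intro f _ hf
    rw [← mul_assoc, uG_uE_ne R G hf.symm, zero_mul]

theorem uG_pp_not {S : Finset G.E} {e : G.E} (h : e ∉ S) : uG R G e * pp R G S = 0 := by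
  rw [pp, Finset.mul_sum]
  refine Finset.sum_eq_zero fun f hf => ?_
  rw [← mul_assoc, uG_uE_ne R G (by rintro rfl; exact h hf), zero_mul]

theorem NN_unit (n : ℕ) : ∀ z ∈ NN R G n, ∃ S : Finset G.E, ∀ T, S ⊆ T →
    pp R G T * z = z ∧ z * pp R G T = z := by
  classical
  refine NN_induction R G ?_ ?_ ?_ ?_
  · intro e f y _
    refine ⟨{e, f}, fun T hT => ⟨?_, ?_⟩⟩
    · rw [← mul_assoc, ← mul_assoc, pp_uE R G (hT (by simp))]
    · rw [mul_assoc, uG_pp R G (hT (by simp))]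
  · exact ⟨∅, by simp⟩
  · rintro x y ⟨S, hS⟩ ⟨S', hS'⟩
    refine ⟨S ∪ S', fun T hT => ?_⟩
    have h1 := hS T (Finset.union_subset_left hT)
    have h2 := hS' T (Finset.union_subset_right hT)
    rw [mul_add, add_mul, h1.1, h1.2, h2.1, h2.2]
    exact ⟨rfl, rfl⟩
  · rintro r x ⟨S, hS⟩
    refine ⟨S, fun T hT => ?_⟩
    rw [mul_smul_comm, smul_mul_assoc, (hS T hT).1, (hS T hT).2]
    exact ⟨rfl, rfl⟩

theorem FF_unit : ∀ n, ∀ z ∈ FF R G n, ∃ S : Finset G.V, ∀ T, S ⊆ T →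
    (∑ v ∈ T, uV R G v) * z = z ∧ z * (∑ v ∈ T, uV R G v) = z := by
  classical
  refine FF_induction R G ?_ ?_ ?_ ?_ ?_
  · intro n v
    refine ⟨{v}, fun T hT => ⟨?_, ?_⟩⟩
    · rw [Finset.sum_mul, Finset.sum_eq_single_of_mem v (hT (by simp)), uV_self]
      intro f _ hf; exact uV_ne R G hf
    · rw [Finset.mul_sum, Finset.sum_eq_single_of_mem v (hT (by simp)), uV_self]
      intro f _ hf; exact uV_ne R G hf.symm
  · exact fun n => ⟨∅, by simp⟩
  · intro n e f y _
    refine ⟨{G.src e, G.src f}, fun T hT => ⟨?_, ?_⟩⟩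
    · rw [← mul_assoc, ← mul_assoc, Finset.sum_mul,
        Finset.sum_eq_single_of_mem (G.src e) (hT (by simp)), src_uE]
      intro v _ hv; exact uV_uE_ne R G hv
    · rw [mul_assoc, Finset.mul_sum,
        Finset.sum_eq_single_of_mem (G.src f) (hT (by simp)), uG_src]
      intro v _ hv; exact uG_uV_ne R G hv.symm
  · rintro n x y ⟨S, hS⟩ ⟨S', hS'⟩
    refine ⟨S ∪ S', fun T hT => ?_⟩
    have h1 := hS T (Finset.union_subset_left hT)
    have h2 := hS' T (Finset.union_subset_right hT)
    rw [mul_add, add_mul, h1.1, h1.2, h2.1, h2.2]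
    exact ⟨rfl, rfl⟩
  · rintro n r x ⟨S, hS⟩
    refine ⟨S, fun T hT => ?_⟩
    rw [mul_smul_comm, smul_mul_assoc, (hS T hT).1, (hS T hT).2]
    exact ⟨rfl, rfl⟩

theorem uPath_nil (u : G.V) : uPath R G u [] = uV R G u := by simp [uPath, uV]

theorem uGhostPath_nil (u : G.V) : uGhostPath R G u [] = uV R G u := by simp [uGhostPath, uV]

theorem uPath_cons (e : G.E) (es : List G.E) :
    uPath R G (G.src e) (e :: es) = uE R G e * uPath R G (G.rng e) es := by
  have h : uPath R G (G.src e) (e :: es)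
      = uV R G (G.src e) * (uE R G e * (es.map fun e => ugen R G (LGen.edge e)).prod) := by
    simp [uPath, uV, uE]
  have h' : uPath R G (G.rng e) es
      = uV R G (G.rng e) * (es.map fun e => ugen R G (LGen.edge e)).prod := rfl
  rw [h, h', ← mul_assoc, ← mul_assoc, src_uE, uE_rng]

theorem uGhostPath_cons (e : G.E) (es : List G.E) :
    uGhostPath R G (G.src e) (e :: es) = uGhostPath R G (G.rng e) es * uG R G e := by
  have h : uGhostPath R G (G.src e) (e :: es)
      = ((es.map fun e => ugen R G (LGen.ghost e)).reverse).prod * uG R G e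
        * uV R G (G.src e) := by
    simp [uGhostPath, uV, uG]
  have h' : uGhostPath R G (G.rng e) es
      = ((es.map fun e => ugen R G (LGen.ghost e)).reverse).prod * uV R G (G.rng e) := rfl
  rw [h, h', mul_assoc, mul_assoc, uG_src, rng_uG]

theorem uV_uPath (u : G.V) (es : List G.E) : uV R G u * uPath R G u es = uPath R G u es := by
  have h' : uPath R G u es
      = uV R G u * (es.map fun e => ugen R G (LGen.edge e)).prod := rfl
  rw [h', ← mul_assoc, uV_self]

theorem uGhostPath_uV (u : G.V) (es : List G.E) :
    uGhostPath R G u es * uV R G u = uGhostPath R G u es := by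
  have h' : uGhostPath R G u es
      = ((es.map fun e => ugen R G (LGen.ghost e)).reverse).prod * uV R G u := rfl
  rw [h', mul_assoc, uV_self]

theorem monomial_mem {w : G.V} {es : List G.E} {u : G.V} (h : IsPathFrom G u es w) :
    ∀ {u' : G.V} {es' : List G.E}, IsPathFrom G u' es' w → es.length = es'.length →
      uPath R G u es * uGhostPath R G u' es' ∈ FF R G es.length := by
  induction h with
  | nil v =>
    intro u' es' h' hl
    cases h' with
    | nil => rw [uPath_nil, uGhostPath_nil, uV_self]; exact uV_mem_FF R G _ _
    | cons e h ht => simp at hl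
  | cons e h ht ih =>
    intro u' es' h' hl
    cases h' with
    | nil => simp at hl
    | cons f h2 ht2 =>
      subst h h2
      rw [uPath_cons, uGhostPath_cons]
      have := ih ht2 (by simpa using hl)
      refine NN_le R G _ ?_
      have h3 := edge_mem_FF R G _ e f this
      simpa only [mul_assoc] using h3

theorem component_mem (x : LeavittPathAlgebra R G) (hx : x ∈ component R G 0) :
    ∃ n, (x : Ambient R G) ∈ FF R G n := by
  unfold component at hx
  induction hx using Submodule.span_induction with
  | mem x h =>
    obtain ⟨u, es, u', es', w, h1, h2, h3, rfl⟩ := h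
    exact ⟨_, monomial_mem R G h1 h2 (by omega)⟩
  | zero => exact ⟨0, zero_mem _⟩
  | add x y _ _ hx hy =>
    obtain ⟨n, hn⟩ := hx
    obtain ⟨m, hm⟩ := hy
    exact ⟨max n m, add_mem (FF_mono R G (le_max_left n m) hn)
      (FF_mono R G (le_max_right n m) hm)⟩
  | smul r x _ hx =>
    obtain ⟨n, hn⟩ := hx
    exact ⟨n, Submodule.smul_mem _ r hn⟩

theorem main_aux : ∀ (n : ℕ) (a b : G.V) (x : Ambient R G), x ∈ FF R G n →
    uV R G a * x = x → x * uV R G b = x → x ≠ 0 →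
    ∃ (es : List G.E) (wa : G.V) (es' : List G.E) (wb : G.V) (v : G.V) (r : R),
      IsPathFrom G a es wa ∧ IsPathFrom G b es' wb ∧ r ≠ 0 ∧
      uGhostPath R G a es * x * uPath R G b es' = r • uV R G v := by
  intro n
  induction n with
  | zero =>
    intro a b x hx ha hb h0
    obtain ⟨r, hr, _⟩ := corner_zero R G a b x hx
    refine ⟨[], a, [], b, a, r, .nil a, .nil b, ?_, ?_⟩
    · rintro rfl
      rw [ha, hb, zero_smul] at hr
      exact h0 hr
    · rw [uGhostPath_nil, uPath_nil, hr]
  | succ n ih =>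
    intro a b x hx ha hb h0
    obtain ⟨r, z, hz, hr, hr'⟩ := corner_succ R G n a b x hx
    rw [ha, hb] at hr
    obtain ⟨S, hS⟩ := NN_unit R G n z hz
    by_cases h : r = 0
    · rw [h, zero_smul, zero_add] at hr
      subst hr
      have key : ∃ e f, uG R G e * x * uE R G f ≠ 0 := by
        by_contra! hc
        apply h0
        have h1 := hS S subset_rfl
        rw [← h1.1, ← h1.2, pp, Finset.sum_mul]
        refine Finset.sum_eq_zero fun e _ => ?_
        rw [Finset.mul_sum, Finset.mul_sum]
        refine Finset.sum_eq_zero fun f _ => ?_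
        have hre : uE R G e * uG R G e * (x * (uE R G f * uG R G f))
          = uE R G e * (uG R G e * x * uE R G f) * uG R G f := by simp only [mul_assoc]
        rw [hre, hc, mul_zero, zero_mul]
      obtain ⟨e, f, hef⟩ := key
      have hea : G.src e = a := by
        by_contra hne
        apply hef
        rw [← ha, ← mul_assoc, uG_uV_ne R G hne, zero_mul, zero_mul]
      have hfb : b = G.src f := by
        by_contra hne
        apply hef
        rw [← hb, mul_assoc, mul_assoc, uV_uE_ne R G hne, mul_zero, mul_zero]
      obtain ⟨es, wa, es', wb, v, r, h1, h2, h3, h4⟩ := ih (G.rng e) (G.rng f) _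
        (FF_compress R G n e f x hz)
        (by rw [← mul_assoc, ← mul_assoc, rng_uG]) (by rw [mul_assoc, uE_rng]) hef
      refine ⟨e :: es, wa, f :: es', wb, v, r, .cons e hea h1, .cons f hfb.symm h2, h3, ?_⟩
      subst hea hfb
      rw [uGhostPath_cons, uPath_cons, ← h4]
      simp only [mul_assoc]
    · obtain ⟨hab, hreg⟩ := hr' h
      subst hab
      by_cases hinf : {e : G.E | G.src e = a}.Finite
      · have hemp : ∀ e, G.src e ≠ a := fun e he => hreg ⟨hinf, ⟨e, he⟩⟩
        have hz0 : uV R G a * z = 0 := by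
          rw [← (hS S subset_rfl).1, pp, Finset.sum_mul, Finset.mul_sum]
          refine Finset.sum_eq_zero fun e _ => ?_
          rw [← mul_assoc, ← mul_assoc, uV_uE_ne R G (hemp e).symm, zero_mul, zero_mul]
        refine ⟨[], a, [], a, a, r, .nil a, .nil a, h, ?_⟩
        rw [uGhostPath_nil, uPath_nil, ha, hb, ← ha, hr, mul_add, hz0, mul_smul_comm, uV_self,
          add_zero]
      · obtain ⟨e, he, heS⟩ := Set.Infinite.exists_notMem_finset hinf S
        have he' : G.src e = a := he
        refine ⟨[e], G.rng e, [e], G.rng e, G.rng e, r, .cons e he' (.nil _),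
          .cons e he' (.nil _), h, ?_⟩
        subst he'
        have hz0 : uG R G e * z = 0 := by
          rw [← (hS S subset_rfl).1, ← mul_assoc, uG_pp_not R G heS, zero_mul]
        rw [uGhostPath_cons, uPath_cons, uGhostPath_nil, uPath_nil, rng_uG, uE_rng, hr, mul_add,
          hz0, add_zero, mul_smul_comm, smul_mul_assoc, uG_src, uG_uE_self]

end Helpers

end LPAGraph

open LPAGraph in
/-- **Lemma.**  If `x ∈ L_R(E)₀` and `x ≠ 0`, then there exist paths `α, β ∈ E*` such that
`α* x β = r • v` for some vertex `v ∈ E⁰` and some `r ∈ R \ {0}`. -/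
theorem stmt4 (R : Type) [CommRing R] (G : LPAGraph) (x : LeavittPathAlgebra R G)
    (hx : x ∈ component R G 0) (hx0 : x ≠ 0) :
    ∃ (u : G.V) (es : List G.E) (wa : G.V) (u' : G.V) (es' : List G.E) (wb : G.V)
      (v : G.V) (r : R),
      IsPathFrom G u es wa ∧ IsPathFrom G u' es' wb ∧ r ≠ 0 ∧
      ghostPathElem R G u es * x * pathElem R G u' es' = r • vertexElem R G v := by
  obtain ⟨n, hn⟩ := component_mem R G x hx
  have hxa : (x : Ambient R G) ≠ 0 := fun h => hx0 (Subtype.ext h)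
  obtain ⟨S, hS⟩ := FF_unit R G n _ hn
  have key : ∃ a b, uV R G a * (x : Ambient R G) * uV R G b ≠ 0 := by
    by_contra! hc
    apply hxa
    have h1 := hS S subset_rfl
    rw [← h1.2, ← h1.1, Finset.sum_mul, Finset.sum_mul]
    refine Finset.sum_eq_zero fun a _ => ?_
    rw [Finset.mul_sum]
    exact Finset.sum_eq_zero fun b _ => hc a b
  obtain ⟨a, b, hab⟩ := key
  obtain ⟨es, wa, es', wb, v, r, h1, h2, h3, h4⟩ := main_aux R G n a b _
    (FF_corner_right R G b n _ (FF_corner_left R G a n _ hn))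
    (by rw [← mul_assoc, ← mul_assoc, uV_self]) (by rw [mul_assoc, uV_self]) hab
  refine ⟨a, es, wa, b, es', wb, v, r, h1, h2, h3, Subtype.ext ?_⟩
  have hre : uGhostPath R G a es * (uV R G a * (x : Ambient R G) * uV R G b) * uPath R G b es'
      = (uGhostPath R G a es * uV R G a) * (x : Ambient R G) * (uV R G b * uPath R G b es') := by
    simp only [mul_assoc]
  rw [hre, uGhostPath_uV, uV_uPath] at h4
  exact h4
end
end

section
/- (Graded Uniqueness Theorem) Let E be a graph and R a commutative ring with unit. If S is a Z-graded ring and φ : L_R(E) → S is a graded ring homomorphism such that φ(rv) ≠ 0 for every vertex v ∈ E⁰ and every r ∈ R \ {0}, then φ is injective. -/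
set_option maxHeartbeats 1000000
set_option synthInstance.maxHeartbeats 400000

noncomputable section

namespace LPAGraph
namespace GUT

/-- A Leavitt family in a unital algebra. -/
structure Fam (G : LPAGraph) {A : Type} [Ring A] (p : G.V → A) (q g : G.E → A) : Prop where
  pp : ∀ v, p v * p v = p v
  pp' : ∀ v w, v ≠ w → p v * p w = 0
  pq : ∀ e, p (G.src e) * q e = q e
  qp : ∀ e, q e * p (G.rng e) = q e
  pg : ∀ e, p (G.rng e) * g e = g e
  gp : ∀ e, g e * p (G.src e) = g e
  gq : ∀ e, g e * q e = p (G.rng e)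
  gq' : ∀ e f, e ≠ f → g e * q f = 0
  ck : ∀ (v : G.V) (s : Finset G.E), (∀ e : G.E, e ∈ s ↔ G.src e = v) → s.Nonempty →
    p v = ∑ e ∈ s, q e * g e

section
variable {R : Type} [CommRing R] {G : LPAGraph} {A : Type} [Ring A] [Algebra R A]
  {p : G.V → A} {q g : G.E → A}

theorem Fam.pq' (h : Fam G p q g) (v : G.V) (e : G.E) (hv : v ≠ G.src e) : p v * q e = 0 := by
  rw [← h.pq e, ← mul_assoc, h.pp' _ _ hv, zero_mul]

theorem Fam.qp' (h : Fam G p q g) (v : G.V) (e : G.E) (hv : G.rng e ≠ v) : q e * p v = 0 := by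
  rw [← h.qp e, mul_assoc, h.pp' _ _ hv, mul_zero]

theorem Fam.gp' (h : Fam G p q g) (v : G.V) (e : G.E) (hv : G.src e ≠ v) : g e * p v = 0 := by
  rw [← h.gp e, mul_assoc, h.pp' _ _ hv, mul_zero]

theorem Fam.pg' (h : Fam G p q g) (v : G.V) (e : G.E) (hv : v ≠ G.rng e) : p v * g e = 0 := by
  rw [← h.pg e, ← mul_assoc, h.pp' _ _ hv, zero_mul]

variable (p q g) in
/-- Monomials of degree zero. -/
inductive Mon0 : ℕ → A → Prop
  | vert (n : ℕ) (v : G.V) : Mon0 n (p v)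
  | step (n : ℕ) (e f : G.E) (y : A) (hy : Mon0 n y) : Mon0 (n + 1) (q e * y * g f)

theorem Mon0.succ {n : ℕ} {y : A} (h : Mon0 p q g n y) : Mon0 p q g (n + 1) y := by
  induction h with
  | vert n v => exact .vert _ v
  | step n e f y hy ih => exact .step _ e f y ih

theorem Mon0.mono {n m : ℕ} (hnm : n ≤ m) {y : A} (h : Mon0 p q g n y) : Mon0 p q g m y := by
  induction hnm with
  | refl => exact h
  | step _ ih => exact ih.succ

theorem Mon0.left (h : Fam G p q g) {n : ℕ} {y : A} (hy : Mon0 p q g n y) (v : G.V) :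
    p v * y = y ∨ p v * y = 0 := by
  cases hy with
  | vert n w =>
    by_cases hv : v = w
    · subst hv; exact .inl (h.pp v)
    · exact .inr (h.pp' _ _ hv)
  | step n e f y hy =>
    by_cases hv : v = G.src e
    · subst hv; left; rw [← mul_assoc, ← mul_assoc, h.pq]
    · right; rw [← mul_assoc, ← mul_assoc, h.pq' _ _ hv, zero_mul, zero_mul]

theorem Mon0.right (h : Fam G p q g) {n : ℕ} {y : A} (hy : Mon0 p q g n y) (v : G.V) :
    y * p v = y ∨ y * p v = 0 := by
  cases hy with
  | vert n w =>
    by_cases hv : w = v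
    · subst hv; exact .inl (h.pp w)
    · exact .inr (h.pp' _ _ hv)
  | step n e f y hy =>
    by_cases hv : G.src f = v
    · subst hv; left; rw [mul_assoc, h.gp]
    · right; rw [mul_assoc, h.gp' _ _ hv, mul_zero]

variable (R p q g) in
/-- span of `Mon0 n`. -/
def M (n : ℕ) : Submodule R A := Submodule.span R {y | Mon0 p q g n y}

variable (R p q g) in
/-- span of the steps. -/
def B (n : ℕ) : Submodule R A :=
  Submodule.span R {z | ∃ (e f : G.E) (y : A), Mon0 p q g n y ∧ z = q e * y * g f}

theorem mon_corner (h : Fam G p q g) {n : ℕ} {y : A} (hy : Mon0 p q g (n + 1) y) (e f : G.E) :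
    g e * y * q f ∈ M R p q g n := by
  cases hy with
  | vert n w =>
    by_cases hw : G.src e = w
    · subst hw
      rw [h.gp]
      by_cases hef : e = f
      · subst hef; rw [h.gq]; exact Submodule.subset_span (.vert _ _)
      · rw [h.gq' _ _ hef]; exact zero_mem _
    · rw [h.gp' _ _ hw, zero_mul]; exact zero_mem _
  | step n e' f' y hy =>
    have : g e * (q e' * y * g f') * q f = (g e * q e') * y * (g f' * q f) := by noncomm_ring
    rw [this]
    by_cases hef : e = e'
    · subst hef
      by_cases hf : f' = f
      · subst hf
        rw [h.gq, h.gq]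
        rcases hy.left h (G.rng e) with h1 | h1 <;> rw [h1]
        · rcases hy.right h (G.rng f') with h2 | h2 <;> rw [h2]
          · exact Submodule.subset_span hy
          · exact zero_mem _
        · rw [zero_mul]; exact zero_mem _
      · rw [h.gq' _ _ hf, mul_zero]; exact zero_mem _
    · rw [h.gq' _ _ hef, zero_mul, zero_mul]; exact zero_mem _

theorem corner (h : Fam G p q g) {n : ℕ} {x : A} (hx : x ∈ M R p q g (n + 1)) (e f : G.E) :
    g e * x * q f ∈ M R p q g n := by
  induction hx using Submodule.span_induction with
  | mem x hx => exact mon_corner h hx e f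
  | zero => simp
  | add x y _ _ hx hy => rw [mul_add, add_mul]; exact add_mem hx hy
  | smul r x _ hx =>
    rw [mul_smul_comm, smul_mul_assoc]; exact Submodule.smul_mem _ _ hx

theorem step_left (h : Fam G p q g) (e : G.E) (z : A) (F : Finset G.E) (he : e ∈ F) :
    ∑ e' ∈ F, q e' * g e' * (q e * z) = q e * z := by
  rw [Finset.sum_eq_single_of_mem e he]
  · rw [← mul_assoc, mul_assoc (q e), h.gq, h.qp]
  · intro b _ hb
    rw [← mul_assoc, mul_assoc (q b), h.gq' _ _ hb, mul_zero, zero_mul]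

theorem step_right (h : Fam G p q g) (e : G.E) (z : A) (F : Finset G.E) (he : e ∈ F) :
    ∑ e' ∈ F, (z * g e) * (q e' * g e') = z * g e := by
  rw [Finset.sum_eq_single_of_mem e he]
  · rw [mul_assoc, ← mul_assoc (g e), h.gq, h.pg]
  · intro b _ hb
    rw [mul_assoc, ← mul_assoc (g e), h.gq' _ _ hb.symm, zero_mul, mul_zero]

/-- Local left units for spans of elements `q e * y`. -/
theorem span_left (h : Fam G p q g) (T : Set A) (hT : ∀ z ∈ T, ∃ (e : G.E) (y : A), z = q e * y)
    {x : A} (hx : x ∈ Submodule.span R T) :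
    ∃ F : Finset G.E, ∀ F', F ⊆ F' → ∑ e ∈ F', q e * g e * x = x := by
  classical
  induction hx using Submodule.span_induction with
  | mem x hx =>
    obtain ⟨e, y, rfl⟩ := hT x hx
    exact ⟨{e}, fun F' hF => step_left h e y F' (by simpa using hF)⟩
  | zero => exact ⟨∅, by simp⟩
  | add x y _ _ hx hy =>
    obtain ⟨F1, h1⟩ := hx
    obtain ⟨F2, h2⟩ := hy
    refine ⟨F1 ∪ F2, fun F' hF => ?_⟩
    simp only [mul_add, Finset.sum_add_distrib]
    rw [h1 F' (Finset.union_subset_left hF), h2 F' (Finset.union_subset_right hF)]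
  | smul r x _ hx =>
    obtain ⟨F1, h1⟩ := hx
    refine ⟨F1, fun F' hF => ?_⟩
    simp only [mul_smul_comm]
    rw [← Finset.smul_sum, h1 F' hF]

theorem span_right (h : Fam G p q g) (T : Set A) (hT : ∀ z ∈ T, ∃ (e : G.E) (y : A), z = y * g e)
    {x : A} (hx : x ∈ Submodule.span R T) :
    ∃ F : Finset G.E, ∀ F', F ⊆ F' → ∑ e ∈ F', x * (q e * g e) = x := by
  classical
  induction hx using Submodule.span_induction with
  | mem x hx =>
    obtain ⟨e, y, rfl⟩ := hT x hx
    exact ⟨{e}, fun F' hF => step_right h e y F' (by simpa using hF)⟩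
  | zero => exact ⟨∅, by simp⟩
  | add x y _ _ hx hy =>
    obtain ⟨F1, h1⟩ := hx
    obtain ⟨F2, h2⟩ := hy
    refine ⟨F1 ∪ F2, fun F' hF => ?_⟩
    simp only [add_mul, Finset.sum_add_distrib]
    rw [h1 F' (Finset.union_subset_left hF), h2 F' (Finset.union_subset_right hF)]
  | smul r x _ hx =>
    obtain ⟨F1, h1⟩ := hx
    refine ⟨F1, fun F' hF => ?_⟩
    simp only [smul_mul_assoc]
    rw [← Finset.smul_sum, h1 F' hF]

theorem left_zero (h : Fam G p q g) (T : Set A)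
    (hT : ∀ z ∈ T, ∃ (e : G.E) (y : A), z = q e * y)
    {x : A} (hx : x ∈ Submodule.span R T) (h0 : ∀ e, g e * x = 0) : x = 0 := by
  obtain ⟨F, hF⟩ := span_left h T hT hx
  rw [← hF F subset_rfl]
  exact Finset.sum_eq_zero fun e _ => by rw [mul_assoc, h0, mul_zero]

theorem right_zero (h : Fam G p q g) (T : Set A)
    (hT : ∀ z ∈ T, ∃ (e : G.E) (y : A), z = y * g e)
    {x : A} (hx : x ∈ Submodule.span R T) (h0 : ∀ e, x * q e = 0) : x = 0 := by
  obtain ⟨F, hF⟩ := span_right h T hT hx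
  rw [← hF F subset_rfl]
  exact Finset.sum_eq_zero fun e _ => by rw [← mul_assoc, h0, zero_mul]

/-- The abstract properties of the kernel that we need. -/
structure Ker (R : Type) [CommRing R] [Algebra R A] (p : G.V → A) (q g : G.E → A)
    (K : A → Prop) : Prop where
  gl : ∀ e x, K x → K (g e * x)
  qr : ∀ e x, K x → K (x * q e)
  pl : ∀ v x, K x → K (p v * x)
  pr : ∀ v x, K x → K (x * p v)
  vert : ∀ v (r : R), K (r • p v) → r = 0

theorem vert_left (h : Fam G p q g) (c : G.V →₀ R) (v : G.V) :
    p v * Finsupp.linearCombination R p c = c v • p v := by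
  classical
  rw [Finsupp.linearCombination_apply, Finsupp.sum, Finset.mul_sum,
    Finset.sum_eq_single v]
  · rw [mul_smul_comm, h.pp]
  · intro b _ hb
    rw [mul_smul_comm, h.pp' _ _ hb.symm, smul_zero]
  · intro hv
    rw [Finsupp.notMem_support_iff.mp hv, zero_smul, mul_zero]

theorem core0 (h : Fam G p q g) {K : A → Prop} (hK : Ker R p q g K) (n : ℕ) :
    ∀ x ∈ M R p q g n, K x → x = 0 := by
  classical
  induction n with
  | zero =>
    intro x hx hKx
    have hx' : x ∈ Submodule.span R (Set.range p) := by
      refine Submodule.span_mono ?_ hx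
      intro y hy
      cases hy with
      | vert n v => exact ⟨v, rfl⟩
    obtain ⟨c, rfl⟩ := (Finsupp.mem_span_range_iff_exists_finsupp).mp hx'
    have : c = 0 := by
      ext v
      have := hK.pl v _ hKx
      rw [← Finsupp.linearCombination_apply, vert_left h] at this
      exact hK.vert _ _ this
    simp [this]
  | succ n ih =>
    intro x hx hKx
    have hsplit : x ∈ Submodule.span R (Set.range p) ⊔ B R p q g n := by
      rw [B, ← Submodule.span_union]
      refine Submodule.span_mono ?_ hx
      intro y hy
      cases hy with
      | vert n v => exact .inl ⟨v, rfl⟩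
      | step n e f y hy => exact .inr ⟨e, f, y, hy, rfl⟩
    obtain ⟨a, ha, b, hb, hab⟩ := Submodule.mem_sup.mp hsplit
    obtain ⟨c, rfl⟩ := (Finsupp.mem_span_range_iff_exists_finsupp).mp ha
    obtain ⟨F, hF⟩ := span_left h _ (by
      rintro z ⟨e, f, y, -, rfl⟩
      exact ⟨e, y * g f, by rw [mul_assoc]⟩) hb
    have hFb := hF F subset_rfl
    have hxB : x ∈ B R p q g n := by
      rw [← hab]
      refine add_mem (Submodule.sum_mem _ fun v _ => ?_) hb
      by_cases hc : c v = 0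
      · simp [hc]
      by_cases hreg : G.Regular v
      · refine Submodule.smul_mem _ _ ?_
        rw [h.ck v hreg.1.toFinset (by simp) (by simpa using hreg.2)]
        refine Submodule.sum_mem _ fun e _ => Submodule.subset_span
          ⟨e, e, p (G.rng e), .vert _ _, by rw [h.qp]⟩
      · exfalso
        apply hc
        by_cases hsink : ∃ e, G.src e = v ∧ e ∉ F
        · obtain ⟨e, he, heF⟩ := hsink
          have hgb : g e * b = 0 := by
            rw [← hFb, Finset.mul_sum]
            refine Finset.sum_eq_zero fun f hf => ?_
            rw [← mul_assoc, ← mul_assoc, h.gq' e f (fun h => heF (h ▸ hf)), zero_mul, zero_mul]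
          have h1 := hK.qr e _ (hK.gl e _ hKx)
          rw [← hab, mul_add, hgb, add_zero, ← Finsupp.linearCombination_apply, ← h.gp e,
            mul_assoc (g e), vert_left h, mul_smul_comm, h.gp, smul_mul_assoc, h.gq, he] at h1
          exact hK.vert _ _ h1
        · push Not at hsink
          have hnone : ∀ e, G.src e ≠ v := by
            intro e he
            exact hreg ⟨F.finite_toSet.subset fun e he => hsink e he, ⟨e, he⟩⟩
          have hpb : p v * b = 0 := by
            rw [← hFb, Finset.mul_sum]
            refine Finset.sum_eq_zero fun f hf => ?_
            rw [← mul_assoc, ← mul_assoc, h.pq' v f (hnone f).symm, zero_mul, zero_mul]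
          have h1 := hK.pl v _ hKx
          rw [← hab, mul_add, hpb, add_zero, ← Finsupp.linearCombination_apply,
            vert_left h] at h1
          exact hK.vert _ _ h1
    have hz : ∀ e f, g e * x * q f = 0 := fun e f =>
      ih _ (corner h hx e f) (hK.qr f _ (hK.gl e _ hKx))
    refine right_zero h _ ?_ hxB fun f => ?_
    · rintro z ⟨e, f, y, -, rfl⟩
      exact ⟨f, _, rfl⟩
    · obtain ⟨F, hF⟩ := span_left h _ (by
        rintro z ⟨e, f, y, -, rfl⟩
        exact ⟨e, y * g f, by rw [mul_assoc]⟩) hxB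
      rw [← hF F subset_rfl, Finset.sum_mul]
      refine Finset.sum_eq_zero fun e _ => ?_
      rw [mul_assoc, mul_assoc, ← mul_assoc (g e), hz, mul_zero]

variable (p q g) in
/-- Monomials of degree `k`. -/
inductive Pos : ℕ → A → Prop
  | base (n : ℕ) (y : A) (hy : Mon0 p q g n y) : Pos 0 y
  | step (k : ℕ) (e : G.E) (y : A) (hy : Pos k y) : Pos (k + 1) (q e * y)

variable (p q g) in
/-- Monomials of degree `-k`. -/
inductive Neg : ℕ → A → Prop
  | base (n : ℕ) (y : A) (hy : Mon0 p q g n y) : Neg 0 y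
  | step (k : ℕ) (e : G.E) (y : A) (hy : Neg k y) : Neg (k + 1) (y * g e)

theorem Pos.left (h : Fam G p q g) {n : ℕ} {y : A} (hy : Pos p q g n y) (v : G.V) :
    p v * y = y ∨ p v * y = 0 := by
  cases hy with
  | base n y hy => exact hy.left h v
  | step k e y hy =>
    by_cases hv : v = G.src e
    · subst hv; left; rw [← mul_assoc, h.pq]
    · right; rw [← mul_assoc, h.pq' _ _ hv, zero_mul]

theorem Neg.right (h : Fam G p q g) {n : ℕ} {y : A} (hy : Neg p q g n y) (v : G.V) :
    y * p v = y ∨ y * p v = 0 := by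
  cases hy with
  | base n y hy => exact hy.right h v
  | step k e y hy =>
    by_cases hv : G.src e = v
    · subst hv; left; rw [mul_assoc, h.gp]
    · right; rw [mul_assoc, h.gp' _ _ hv, mul_zero]

theorem core_zero (h : Fam G p q g) {K : A → Prop} (hK : Ker R p q g K) (T : Set A)
    (hT : ∀ y ∈ T, ∃ n, Mon0 p q g n y) (x : A) (hx : x ∈ Submodule.span R T) (hKx : K x) :
    x = 0 := by
  have : ∃ n, ∀ m, n ≤ m → x ∈ M R p q g m := by
    clear hKx
    induction hx using Submodule.span_induction with
    | mem x hx =>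
      obtain ⟨n, hn⟩ := hT x hx
      exact ⟨n, fun m hm => Submodule.subset_span (hn.mono hm)⟩
    | zero => exact ⟨0, fun _ _ => zero_mem _⟩
    | add x y _ _ hx hy =>
      obtain ⟨a, ha⟩ := hx
      obtain ⟨b, hb⟩ := hy
      exact ⟨max a b, fun m hm => add_mem (ha m (le_of_max_le_left hm))
        (hb m (le_of_max_le_right hm))⟩
    | smul r x _ hx =>
      obtain ⟨a, ha⟩ := hx
      exact ⟨a, fun m hm => Submodule.smul_mem _ _ (ha m hm)⟩
  obtain ⟨n, hn⟩ := this
  exact core0 h hK n x (hn n le_rfl) hKx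

theorem core_pos (h : Fam G p q g) {K : A → Prop} (hK : Ker R p q g K) (k : ℕ) :
    ∀ x ∈ Submodule.span R {y | Pos p q g k y}, K x → x = 0 := by
  induction k with
  | zero =>
    intro x hx hKx
    refine core_zero h hK _ ?_ x hx hKx
    intro y hy
    cases hy with
    | base n y hy => exact ⟨n, hy⟩
  | succ k ih =>
    intro x hx hKx
    refine left_zero h _ ?_ hx fun e => ih _ ?_ (hK.gl e _ hKx)
    · intro z hz
      cases hz with
      | step k e y hy => exact ⟨e, y, rfl⟩
    · clear hKx
      induction hx using Submodule.span_induction with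
      | mem x hx =>
        cases hx with
        | step k e' y hy =>
          rw [← mul_assoc]
          by_cases hee : e = e'
          · subst hee
            rw [h.gq]
            rcases hy.left h (G.rng e) with h1 | h1 <;> rw [h1]
            · exact Submodule.subset_span hy
            · exact zero_mem _
          · rw [h.gq' _ _ hee, zero_mul]; exact zero_mem _
      | zero => simp
      | add x y _ _ hx hy => rw [mul_add]; exact add_mem hx hy
      | smul r x _ hx => rw [mul_smul_comm]; exact Submodule.smul_mem _ _ hx

theorem core_neg (h : Fam G p q g) {K : A → Prop} (hK : Ker R p q g K) (k : ℕ) :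
    ∀ x ∈ Submodule.span R {y | Neg p q g k y}, K x → x = 0 := by
  induction k with
  | zero =>
    intro x hx hKx
    refine core_zero h hK _ ?_ x hx hKx
    intro y hy
    cases hy with
    | base n y hy => exact ⟨n, hy⟩
  | succ k ih =>
    intro x hx hKx
    refine right_zero h _ ?_ hx fun e => ih _ ?_ (hK.qr e _ hKx)
    · intro z hz
      cases hz with
      | step k e y hy => exact ⟨e, y, rfl⟩
    · clear hKx
      induction hx using Submodule.span_induction with
      | mem x hx =>
        cases hx with
        | step k e' y hy =>
          rw [mul_assoc]
          by_cases hee : e' = e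
          · subst hee
            rw [h.gq]
            rcases hy.right h (G.rng e') with h1 | h1 <;> rw [h1]
            · exact Submodule.subset_span hy
            · exact zero_mem _
          · rw [h.gq' _ _ hee, mul_zero]; exact zero_mem _
      | zero => simp
      | add x y _ _ hx hy => rw [add_mul]; exact add_mem hx hy
      | smul r x _ hx => rw [smul_mul_assoc]; exact Submodule.smul_mem _ _ hx

variable (p q) in
/-- path -/
def pa (u : G.V) (es : List G.E) : A := p u * (es.map fun e => q e).prod

variable (p g) in
/-- ghost path -/
def gh (u : G.V) (es : List G.E) : A := ((es.map fun e => g e).reverse).prod * p u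

theorem pa_cons (h : Fam G p q g) (e : G.E) (es : List G.E) :
    pa p q (G.src e) (e :: es) = q e * pa p q (G.rng e) es := by
  simp only [pa, List.map_cons, List.prod_cons]
  rw [← mul_assoc, ← mul_assoc, h.pq, h.qp]

theorem gh_cons (h : Fam G p q g) (e : G.E) (es : List G.E) :
    gh p g (G.src e) (e :: es) = gh p g (G.rng e) es * g e := by
  simp only [gh, List.map_cons, List.reverse_cons, List.prod_append, List.prod_singleton]
  rw [mul_assoc, mul_assoc, h.gp, h.pg]

theorem left_pa (h : Fam G p q g) (u : G.V) (es : List G.E) : p u * pa p q u es = pa p q u es := by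
  rw [pa, ← mul_assoc, h.pp]

theorem left_pa' (h : Fam G p q g) (v u : G.V) (hv : v ≠ u) (es : List G.E) :
    p v * pa p q u es = 0 := by
  rw [pa, ← mul_assoc, h.pp' _ _ hv, zero_mul]

theorem left_gh (h : Fam G p q g) {u w : G.V} {es : List G.E} (hp : IsPathFrom G u es w) :
    p w * gh p g u es = gh p g u es := by
  induction hp with
  | nil v => simp [gh, h.pp]
  | cons e he _ ih => subst he; rw [gh_cons h, ← mul_assoc, ih]

theorem gh_snoc (h : Fam G p q g) {u w : G.V} {es : List G.E} (hp : IsPathFrom G u es w)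
    (e : G.E) (hw : G.src e = w) :
    g e * gh p g u es = gh p g u (es ++ [e]) ∧ IsPathFrom G u (es ++ [e]) (G.rng e) := by
  refine ⟨by simp [gh, mul_assoc], ?_⟩
  induction hp with
  | nil v => exact .cons e hw (.nil _)
  | cons e' he _ ih => exact .cons e' he (ih hw)

variable (p q g) in
/-- monomials -/
def Mono : Set A := {x | ∃ (u : G.V) (es : List G.E) (u' : G.V) (es' : List G.E) (w : G.V),
    IsPathFrom G u es w ∧ IsPathFrom G u' es' w ∧ x = pa p q u es * gh p g u' es'}

theorem mono_p (h : Fam G p q g) (v : G.V) : p v ∈ Mono p q g :=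
  ⟨v, [], v, [], v, .nil _, .nil _, by simp [pa, gh, h.pp]⟩

theorem mono_q (h : Fam G p q g) (e : G.E) : q e ∈ Mono p q g :=
  ⟨G.src e, [e], G.rng e, [], _, .cons e rfl (.nil _), .nil _, by
    rw [pa_cons h]; simp [pa, gh, mul_assoc, h.pp, h.qp]⟩

theorem mono_g (h : Fam G p q g) (e : G.E) : g e ∈ Mono p q g :=
  ⟨G.rng e, [], G.src e, [e], _, .nil _, .cons e rfl (.nil _), by
    rw [gh_cons h]; simp [pa, gh, ← mul_assoc, h.pp, h.pg]⟩

theorem mono_mul (h : Fam G p q g) (x : A) (hx : (∃ v, x = p v) ∨ (∃ e, x = q e) ∨ ∃ e, x = g e)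
    (y : A) (hy : y ∈ Mono p q g) : x * y ∈ Mono p q g ∨ x * y = 0 := by
  obtain ⟨u, es, u', es', w, h1, h2, rfl⟩ := hy
  rw [← mul_assoc]
  rcases hx with ⟨v, rfl⟩ | ⟨e, rfl⟩ | ⟨e, rfl⟩
  · by_cases hv : v = u
    · subst hv
      rw [left_pa h]
      exact .inl ⟨v, es, u', es', w, h1, h2, rfl⟩
    · rw [left_pa' h _ _ hv, zero_mul]; exact .inr rfl
  · by_cases hv : G.rng e = u
    · subst hv
      rw [← pa_cons h]
      exact .inl ⟨_, e :: es, u', es', w, .cons e rfl h1, h2, rfl⟩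
    · right; rw [pa, ← mul_assoc, h.qp' _ _ hv, zero_mul, zero_mul]
  · cases h1 with
    | nil =>
      by_cases hv : G.src e = u
      · have := gh_snoc h h2 e hv
        refine .inl ⟨G.rng e, [], u', es' ++ [e], G.rng e, .nil _, this.2, ?_⟩
        have h3 := left_gh h this.2
        have h4 : pa p q (G.rng e) [] = p (G.rng e) := by simp [pa]
        rw [h4, h3, ← this.1]
        subst hv
        simp [pa, h.gp]
      · right; simp [pa, h.gp' _ _ hv]
    | cons e' he ht =>
      rename_i es
      subst he
      rw [pa_cons h, ← mul_assoc]
      by_cases hee : e = e'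
      · subst hee
        rw [h.gq, left_pa h]
        exact .inl ⟨_, es, u', es', w, ht, h2, rfl⟩
      · right; rw [h.gq' _ _ hee, zero_mul, zero_mul]

theorem span_mul (h : Fam G p q g) (x : A)
    (hx : (∃ v, x = p v) ∨ (∃ e, x = q e) ∨ ∃ e, x = g e)
    (y : A) (hy : y ∈ Submodule.span R (Mono p q g)) :
    x * y ∈ Submodule.span R (Mono p q g) := by
  induction hy using Submodule.span_induction with
  | mem y hy =>
    rcases mono_mul h x hx y hy with h1 | h1
    · exact Submodule.subset_span h1
    · rw [h1]; exact zero_mem _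
  | zero => simp
  | add a b _ _ ha hb => rw [mul_add]; exact add_mem ha hb
  | smul r a _ ha => rw [mul_smul_comm]; exact Submodule.smul_mem _ _ ha

theorem mono_zero (h : Fam G p q g) (es : List G.E) : ∀ (u u' w : G.V) (es' : List G.E),
    IsPathFrom G u es w → IsPathFrom G u' es' w → es.length = es'.length →
    Mon0 p q g es.length (pa p q u es * gh p g u' es') := by
  induction es with
  | nil =>
    intro u u' w es' h1 h2 hl
    have : es' = [] := List.length_eq_zero_iff.mp hl.symm
    subst this
    cases h1
    cases h2
    simp only [pa, gh, List.map_nil, List.prod_nil, mul_one, List.reverse_nil, one_mul, h.pp]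
    exact .vert _ _
  | cons e es ih =>
    intro u u' w es' h1 h2 hl
    cases h2 with
    | nil => simp at hl
    | cons f hf ht =>
      cases h1 with
      | cons e he hs =>
        subst he hf
        rw [pa_cons h, gh_cons h, mul_assoc, ← mul_assoc (pa p q _ _), ← mul_assoc]
        exact .step _ _ _ _ (ih _ _ _ _ hs ht (by simpa using hl))

theorem mono_pos (h : Fam G p q g) (k : ℕ) : ∀ (u u' w : G.V) (es es' : List G.E),
    IsPathFrom G u es w → IsPathFrom G u' es' w → es.length = es'.length + k →
    Pos p q g k (pa p q u es * gh p g u' es') := by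
  induction k with
  | zero =>
    intro u u' w es es' h1 h2 hl
    exact .base _ _ (mono_zero h _ _ _ _ _ h1 h2 hl)
  | succ k ih =>
    intro u u' w es es' h1 h2 hl
    cases h1 with
    | nil => simp at hl
    | cons e he hs =>
      subst he
      rw [pa_cons h, mul_assoc]
      exact .step _ _ _ (ih _ _ _ _ _ hs h2 (by simp at hl; omega))

theorem mono_neg (h : Fam G p q g) (k : ℕ) : ∀ (u u' w : G.V) (es es' : List G.E),
    IsPathFrom G u es w → IsPathFrom G u' es' w → es'.length = es.length + k →
    Neg p q g k (pa p q u es * gh p g u' es') := by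
  induction k with
  | zero =>
    intro u u' w es es' h1 h2 hl
    exact .base _ _ (mono_zero h _ _ _ _ _ h1 h2 hl.symm)
  | succ k ih =>
    intro u u' w es es' h1 h2 hl
    cases h2 with
    | nil => simp at hl
    | cons e he hs =>
      subst he
      rw [gh_cons h, ← mul_assoc]
      exact .step _ _ _ (ih _ _ _ _ _ h1 hs (by simp at hl; omega))

end

section
variable (R : Type) [CommRing R] (G : LPAGraph)

theorem rel {a b : FreeAlgebra R (LGen G)} (hab : LeavittRel R G a b) :
    RingQuot.mkAlgHom R (LeavittRel R G) a = RingQuot.mkAlgHom R (LeavittRel R G) b :=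
  RingQuot.mkAlgHom_rel R hab

theorem fam : Fam G (fun v => ugen R G (.vert v)) (fun e => ugen R G (.edge e))
    (fun e => ugen R G (.ghost e)) where
  pp v := by simpa [ugen] using rel R G (.vert_mul_self v)
  pp' v w hvw := by simpa [ugen] using rel R G (.vert_mul_vert v w hvw)
  pq e := by simpa [ugen] using rel R G (.src_mul_edge e)
  qp e := by simpa [ugen] using rel R G (.edge_mul_rng e)
  pg e := by simpa [ugen] using rel R G (.rng_mul_ghost e)
  gp e := by simpa [ugen] using rel R G (.ghost_mul_src e)
  gq e := by simpa [ugen] using rel R G (.ghost_mul_self e)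
  gq' e f hef := by simpa [ugen] using rel R G (.ghost_mul_edge e f hef)
  ck v s hs hne := by simpa [ugen] using rel R G (.ck v s hs hne)

theorem mem_span_mono (x : Ambient R G) (hx : x ∈ LeavittSubalgebra R G) :
    x ∈ Submodule.span R (Mono (fun v => ugen R G (.vert v)) (fun e => ugen R G (.edge e))
      (fun e => ugen R G (.ghost e))) := by
  have h := fam R G
  suffices hs : x ∈ Submodule.span R (Mono (fun v => ugen R G (.vert v))
      (fun e => ugen R G (.edge e)) (fun e => ugen R G (.ghost e))) ∧
      ∀ y ∈ Submodule.span R (Mono (fun v => ugen R G (.vert v))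
      (fun e => ugen R G (.edge e)) (fun e => ugen R G (.ghost e))),
      x * y ∈ Submodule.span R (Mono (fun v => ugen R G (.vert v))
      (fun e => ugen R G (.edge e)) (fun e => ugen R G (.ghost e))) from hs.1
  induction hx using NonUnitalAlgebra.adjoin_induction with
  | mem x hx =>
    obtain ⟨a, rfl⟩ := hx
    cases a with
    | vert v => exact ⟨Submodule.subset_span (mono_p h v), span_mul h _ (.inl ⟨v, rfl⟩)⟩
    | edge v => exact ⟨Submodule.subset_span (mono_q h v), span_mul h _ (.inr (.inl ⟨v, rfl⟩))⟩
    | ghost v => exact ⟨Submodule.subset_span (mono_g h v), span_mul h _ (.inr (.inr ⟨v, rfl⟩))⟩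
  | add x y _ _ hx hy =>
    exact ⟨add_mem hx.1 hy.1, fun z hz => by
      rw [add_mul]; exact add_mem (hx.2 z hz) (hy.2 z hz)⟩
  | zero => exact ⟨zero_mem _, fun z _ => by rw [zero_mul]; exact zero_mem _⟩
  | mul x y _ _ hx hy =>
    exact ⟨hx.2 _ hy.1, fun z hz => by rw [mul_assoc]; exact hx.2 _ (hy.2 z hz)⟩
  | smul r x _ hx =>
    exact ⟨Submodule.smul_mem _ _ hx.1, fun z hz => by
      rw [smul_mul_assoc]; exact Submodule.smul_mem _ _ (hx.2 z hz)⟩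

theorem mem_iSup (x : LeavittPathAlgebra R G) : x ∈ ⨆ k, component R G k := by
  obtain ⟨x, hx⟩ := x
  have hs := mem_span_mono R G x hx
  suffices H : ∃ y ∈ ⨆ k, component R G k, (y : Ambient R G) = x by
    obtain ⟨y, hy, rfl⟩ := H
    exact hy
  clear hx
  induction hs using Submodule.span_induction with
  | mem x hx =>
    obtain ⟨u, es, u', es', w, h1, h2, rfl⟩ := hx
    refine ⟨pathElem R G u es * ghostPathElem R G u' es', ?_, rfl⟩
    exact Submodule.mem_iSup_of_mem ((es.length : ℤ) - es'.length)
      (Submodule.subset_span ⟨u, es, u', es', w, h1, h2, rfl, rfl⟩)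
  | zero => exact ⟨0, zero_mem _, rfl⟩
  | add x y _ _ hx hy =>
    obtain ⟨a, ha, rfl⟩ := hx
    obtain ⟨b, hb, rfl⟩ := hy
    exact ⟨a + b, add_mem ha hb, rfl⟩
  | smul r x _ hx =>
    obtain ⟨a, ha, rfl⟩ := hx
    exact ⟨r • a, Submodule.smul_mem _ _ ha, rfl⟩

theorem comp_span (k : ℤ) (x : LeavittPathAlgebra R G) (hx : x ∈ component R G k)
    (T : Set (Ambient R G))
    (hT : ∀ (u : G.V) (es : List G.E) (u' : G.V) (es' : List G.E) (w : G.V),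
      IsPathFrom G u es w → IsPathFrom G u' es' w →
      (es.length : ℤ) - (es'.length : ℤ) = k → uPath R G u es * uGhostPath R G u' es' ∈ T) :
    (x : Ambient R G) ∈ Submodule.span R T := by
  induction hx using Submodule.span_induction with
  | mem x hx =>
    obtain ⟨u, es, u', es', w, h1, h2, h3, rfl⟩ := hx
    exact Submodule.subset_span (hT u es u' es' w h1 h2 h3)
  | zero => exact zero_mem _
  | add x y _ _ hx hy => exact add_mem hx hy
  | smul r x _ hx => exact Submodule.smul_mem _ r hx

theorem homog (S : Type) [NonUnitalRing S] (phi : LeavittPathAlgebra R G →ₙ+* S)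
    (hvert : ∀ (v : G.V) (r : R), r ≠ 0 → phi (r • vertexElem R G v) ≠ 0)
    (k : ℤ) (x : LeavittPathAlgebra R G) (hx : x ∈ component R G k) (h0 : phi x = 0) :
    x = 0 := by
  have h := fam R G
  have hK : Ker R (fun v => ugen R G (.vert v)) (fun e => ugen R G (.edge e))
    (fun e => ugen R G (.ghost e))
    (fun a => ∃ y : LeavittPathAlgebra R G, (y : Ambient R G) = a ∧ phi y = 0) := by
    constructor
    · rintro e _ ⟨y, rfl, hy⟩
      exact ⟨ghostElem R G e * y, rfl, by rw [map_mul, hy, mul_zero]⟩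
    · rintro e _ ⟨y, rfl, hy⟩
      exact ⟨y * edgeElem R G e, rfl, by rw [map_mul, hy, zero_mul]⟩
    · rintro e _ ⟨y, rfl, hy⟩
      exact ⟨vertexElem R G e * y, rfl, by rw [map_mul, hy, mul_zero]⟩
    · rintro e _ ⟨y, rfl, hy⟩
      exact ⟨y * vertexElem R G e, rfl, by rw [map_mul, hy, zero_mul]⟩
    · rintro v r ⟨y, hyr, hy⟩
      by_contra hr
      refine hvert v r hr ?_
      rw [← hy]
      congr 1
      exact Subtype.ext hyr.symm
  apply Subtype.ext
  obtain ⟨n, rfl | rfl⟩ := Int.eq_nat_or_neg k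
  · refine core_pos h hK n _ ?_ ⟨x, rfl, h0⟩
    refine comp_span R G _ x hx _ fun u es u' es' w h1 h2 h3 => ?_
    exact mono_pos h n u u' w es es' h1 h2 (by omega)
  · refine core_neg h hK n _ ?_ ⟨x, rfl, h0⟩
    refine comp_span R G _ x hx _ fun u es u' es' w h1 h2 h3 => ?_
    exact mono_neg h n u u' w es es' h1 h2 (by omega)

end
end GUT
end LPAGraph

open LPAGraph in
/-- **Graded Uniqueness Theorem.**  Let `E` be a graph and `R` a commutative ring with unit.
If `S` is a `ℤ`-graded ring and `φ : L_R(E) → S` is a graded ring homomorphism such that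
`φ(r • v) ≠ 0` for every vertex `v ∈ E⁰` and every `r ∈ R \ {0}`, then `φ` is injective. -/
theorem stmt5 (R : Type) [CommRing R] (G : LPAGraph)
    (S : Type) [NonUnitalRing S] (SG : ℤ → AddSubgroup S)
    (hInternal : DirectSum.IsInternal SG)
    (hGradedMul : ∀ (j k : ℤ), ∀ x ∈ SG j, ∀ y ∈ SG k, x * y ∈ SG (j + k))
    (phi : LeavittPathAlgebra R G →ₙ+* S)
    (hGradedHom : ∀ (k : ℤ), ∀ x ∈ component R G k, phi x ∈ SG k)
    (hvert : ∀ (v : G.V) (r : R), r ≠ 0 → phi (r • vertexElem R G v) ≠ 0) :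
    Function.Injective phi := by
  classical
  rw [injective_iff_map_eq_zero]
  intro x hx
  obtain ⟨f, hf, hsum⟩ := (Submodule.mem_iSup_iff_exists_finsupp _ _).mp (GUT.mem_iSup R G x)
  have hz : ∀ k, phi (f k) = 0 := by
    have key : (∑ k ∈ f.support, DirectSum.of (fun i => SG i) k
        ⟨phi (f k), hGradedHom k _ (hf k)⟩) = 0 := by
      apply hInternal.1
      rw [map_sum, map_zero]
      simp only [DirectSum.coeAddMonoidHom_of]
      rw [← map_sum, ← hx, ← hsum]
      rfl
    intro k
    by_cases hk : k ∈ f.support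
    · have h1 := congrArg (fun t => ((t k : SG k) : S)) key
      simp only [DirectSum.sum_apply] at h1
      rw [Finset.sum_eq_single_of_mem k hk] at h1
      · rw [DirectSum.of_eq_same] at h1
        exact h1
      · intro b _ hb
        exact DirectSum.of_eq_of_ne _ _ _ hb.symm
    · rw [Finsupp.notMem_support_iff.mp hk, map_zero]
  rw [← hsum]
  exact Finset.sum_eq_zero fun k _ => GUT.homog R G S phi hvert k _ (hf k) (hz k)
end
end
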